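/- arXiv:1203.4532 — 3 statements merged into one kernel-verified Lean document; each statement's English description precedes it below -/
import Mathlib

section
/- Let V ⊆ 𝔽̄^n be an affine variety of dimension k ≥ 1 and let I(V) ⊆ 𝔽̄[x_1,…,x_n] be the ideal of all polynomials vanishing on V. Then there exist formal Laurent series h_1(T),…,h_n(T) ∈ 𝔽̄((T)) such that f(h_1(T),…,h_n(T)) = 0 in 𝔽̄((T)) for every f ∈ I(V), and at least one of the h_i has a pole. -/
open MvPolynomial

/-- The zero locus of a set of multivariate polynomials. -/
def zeroLocus (K : Type*) [Field K] (n : ℕ) (S : Set (MvPolynomial (Fin n) K)) :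
    Set (Fin n → K) := {x | ∀ f ∈ S, eval x f = 0}

/-- An affine variety is the common zero set of finitely many polynomials. -/
def IsAffineVariety (K : Type*) [Field K] (n : ℕ) (V : Set (Fin n → K)) : Prop :=
  ∃ s : Finset (MvPolynomial (Fin n) K), V = zeroLocus K n ↑s

/-- The Zariski topology on affine n-space. -/
instance zariskiTopology (K : Type*) [Field K] (n : ℕ) : TopologicalSpace (Fin n → K) :=
  TopologicalSpace.generateFrom
    {U | ∃ S : Set (MvPolynomial (Fin n) K), U = (zeroLocus K n S)ᶜ}

/-- Dimension of a subset of affine space: Krull dimension in the Zariski topology. -/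
noncomputable def vdim (K : Type*) [Field K] (n : ℕ) (V : Set (Fin n → K)) : WithBot ℕ∞ :=
  topologicalKrullDim ↥V

/-- An affine-linear subspace: zero set of polynomials of degree at most one. -/
def IsAffineSubspace (K : Type*) [Field K] (n : ℕ) (L : Set (Fin n → K)) : Prop :=
  ∃ S : Set (MvPolynomial (Fin n) K), (∀ f ∈ S, totalDegree f ≤ 1) ∧ L = zeroLocus K n S

/-- Degree of an irreducible variety: number of intersection points with a generic
(affine-linear) subspace of complementary dimension. -/
noncomputable def irrDegree (K : Type*) [Field K] (n : ℕ) (W : Set (Fin n → K)) : ℕ∞ :=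
  ⨆ (L : Set (Fin n → K)) (_ : IsAffineSubspace K n L)
    (_ : vdim K n W + vdim K n L = (n : WithBot ℕ∞)) (_ : (W ∩ L).Finite),
    ((W ∩ L).ncard : ℕ∞)

/-- Degree of a variety: sum of degrees of its irreducible components. -/
noncomputable def vdeg (K : Type*) [Field K] (n : ℕ) (V : Set (Fin n → K)) : ℕ∞ :=
  ∑' W : irreducibleComponents ↥V, irrDegree K n (Subtype.val '' (W.1 : Set ↥V))

/-- The ideal of polynomials vanishing on a set. -/
noncomputable def vanishingIdeal (K : Type*) [Field K] (n : ℕ) (V : Set (Fin n → K)) :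
    Ideal (MvPolynomial (Fin n) K) where
  carrier := {f | ∀ x ∈ V, eval x f = 0}
  add_mem' {f g} hf hg := fun x hx => by simp [hf x hx, hg x hx]
  zero_mem' := fun x hx => by simp
  smul_mem' := fun c f hf x hx => by simp [hf x hx]

/-- A variety is defined over a subfield `F` if its vanishing ideal is generated by
finitely many polynomials with coefficients in `F`. -/
def DefinedOver (F K : Type*) [Field F] [Field K] [Algebra F K] (n : ℕ)
    (V : Set (Fin n → K)) : Prop :=
  ∃ s : Finset (MvPolynomial (Fin n) F),
    vanishingIdeal K n V = Ideal.span ((MvPolynomial.map (algebraMap F K)) '' ↑s)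

section Expand
open PowerSeries hiding C X coeff_C coeff_C_mul

theorem exists_expansion {K O : Type*} [Field K] [CommRing O] [IsDomain O] [Algebra K O]
    (ρ : O →ₐ[K] K) (π : O) (hπ : π ≠ 0) (hker : ∀ f, ρ f = 0 ↔ π ∣ f) :
    ∃ ψ : O →ₐ[K] K⟦X⟧, ψ π = PowerSeries.X ∧ ∀ f, constantCoeff (ψ f) = ρ f := by
  have hd : ∀ f, ∃ g, f = algebraMap K O (ρ f) + π * g := by
    intro f
    obtain ⟨g, hg⟩ := (hker (f - algebraMap K O (ρ f))).1 (by simp)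
    exact ⟨g, by rw [← hg]; ring⟩
  choose d hd using hd
  have huniq : ∀ f g, f = algebraMap K O (ρ f) + π * g → d f = g := by
    intro f g h
    have h1 := hd f
    have : π * d f = π * g := by
      have := h1.symm.trans h
      exact add_left_cancel this
    exact mul_left_cancel₀ hπ this
  have hadd : ∀ f g, d (f + g) = d f + d g := by
    intro f g
    apply huniq
    conv_lhs => rw [hd f, hd g]
    simp only [map_add]; ring
  have hmul : ∀ f g, d (f * g) = algebraMap K O (ρ f) * d g + d f * g := by
    intro f g
    apply huniq
    conv_lhs => rw [hd f]
    conv_lhs => rw [add_mul]; enter [1]; rw [hd g]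
    simp only [map_mul]; ring
  have hC : ∀ c, d (algebraMap K O c) = 0 := by
    intro c
    apply huniq
    simp
  have hCmul : ∀ c g, d (algebraMap K O c * g) = algebraMap K O c * d g := by
    intro c g
    rw [hmul, hC]; simp
  have hdπ : d π = 1 := by
    apply huniq
    rw [(hker π).2 dvd_rfl]; simp
  let ψ : O → K⟦X⟧ := fun f => PowerSeries.mk fun n => ρ (d^[n] f)
  have c0 : ∀ f, coeff 0 (ψ f) = ρ f := fun f => by simp [ψ]
  have cs : ∀ n f, coeff (n+1) (ψ f) = coeff n (ψ (d f)) := fun n f => by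
    simp [ψ]
  have padd : ∀ f g, ψ (f + g) = ψ f + ψ g := by
    intro f g
    ext n
    induction n generalizing f g with
    | zero => simp only [c0, map_add]
    | succ n ih => simp only [cs, map_add, hadd, ih]
  have psm : ∀ n c f, coeff n (ψ (algebraMap K O c * f)) = c * coeff n (ψ f) := by
    intro n c f
    induction n generalizing f with
    | zero => simp only [c0, map_mul]; simp
    | succ n ih => simp only [cs, hCmul, ih]
  have pstep : ∀ f, ψ f = PowerSeries.C (ρ f) + PowerSeries.X * ψ (d f) := by
    intro f
    ext n
    cases n with
    | zero => rw [c0]; simp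
    | succ n => rw [cs, map_add, coeff_succ_X_mul]; simp
  have pC : ∀ c, ψ (algebraMap K O c) = PowerSeries.C c := by
    intro c
    ext n
    cases n with
    | zero => rw [c0]; simp
    | succ n =>
      rw [cs, hC]
      have := psm n 0 0
      simp only [map_zero, zero_mul] at this
      rw [this]; simp
  have pmul : ∀ f g, ψ (f * g) = ψ f * ψ g := by
    intro f g
    ext n
    induction n generalizing f g with
    | zero => 
      have e : ∀ f, constantCoeff (ψ f) = ρ f := fun f => by simpa using c0 f
      simp [e]
    | succ n ih => 
      rw [cs, hmul, padd, map_add, psm, ih]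
      conv_rhs => rw [pstep f, add_mul, map_add, PowerSeries.coeff_C_mul, cs, mul_assoc, coeff_succ_X_mul]
  refine ⟨{ toFun := ψ, map_one' := ?_, map_mul' := pmul, map_zero' := ?_, map_add' := padd, commutes' := ?_ }, ?_, ?_⟩
  · simpa using pC 1
  · simpa using pC 0
  · intro c; rw [pC]; rfl
  · change ψ π = _
    rw [pstep, hdπ, (hker π).2 dvd_rfl]
    have := pC 1
    simp only [map_one] at this
    rw [this]; simp
  · intro f; simpa using c0 f

end Expand

universe u v

/-- base change and Zariski lemma -/
theorem exists_field_point {K P : Type*} {A : Type u} {F : Type v} [Field K] [CommRing P] [IsDomain P]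
    [IsPrincipalIdealRing P] [CommRing A] [Field F] [Algebra K P] [Algebra K A]
    [Algebra K F] [Algebra.FiniteType K A] (f : P →ₐ[K] A) (g : P →ₐ[K] F)
    (hf : Function.Injective f) (hg : Function.Injective g) :
    ∃ (L : Type (max v u)) (_ : Field L) (_ : Algebra F L) (_ : Module.Finite F L) (φ : A →+* L),
      ∀ p, φ (f p) = algebraMap F L (g p) := by
  let : Algebra P A := f.toRingHom.toAlgebra
  let : Algebra P F := g.toRingHom.toAlgebra
  have : IsScalarTower K P A := IsScalarTower.of_algebraMap_eq fun x => (f.commutes x).symm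
  have : Algebra.FiniteType P A := Algebra.FiniteType.of_restrictScalars_finiteType K P A
  have : Module.IsTorsionFree P F := by
    have : FaithfulSMul P F := (faithfulSMul_iff_algebraMap_injective P F).2 hg
    infer_instance
  have : Module.Flat P F := inferInstance
  have hinj : Function.Injective
    (Algebra.TensorProduct.includeLeft : F →ₐ[P] TensorProduct P F A) :=
    Algebra.TensorProduct.includeLeft_injective (S := P) hf
  have : Nontrivial (TensorProduct P F A) := hinj.nontrivial
  obtain ⟨M, hM⟩ := Ideal.exists_maximal (TensorProduct P F A)
  let := Ideal.Quotient.field M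
  have : Algebra.FiniteType F (TensorProduct P F A ⧸ M) :=
    Algebra.FiniteType.of_surjective (Ideal.Quotient.mkₐ F M) (Ideal.Quotient.mkₐ_surjective F M)
  refine ⟨TensorProduct P F A ⧸ M, inferInstance, inferInstance,
    finite_of_finite_type_of_isJacobsonRing _ _,
    (Ideal.Quotient.mk M).comp (Algebra.TensorProduct.includeRight : A →ₐ[P] TensorProduct P F A).toRingHom, ?_⟩
  intro p
  change Ideal.Quotient.mk M (1 ⊗ₜ[P] (algebraMap P A p)) = Ideal.Quotient.mk M ((algebraMap P F p) ⊗ₜ[P] 1)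
  rw [Algebra.algebraMap_eq_smul_one, Algebra.algebraMap_eq_smul_one, TensorProduct.tmul_smul, TensorProduct.smul_tmul']

section Val
open PowerSeries

theorem finite_quot {K O L : Type*} [Field K] [CommRing O] [IsDomain O] 
    [Algebra K O] [Algebra K⟦X⟧ O] [IsScalarTower K K⟦X⟧ O] [Field L] [Algebra O L] 
    [FaithfulSMul O L]
    [Algebra (LaurentSeries K) L] [Algebra K⟦X⟧ L] [IsScalarTower K⟦X⟧ (LaurentSeries K) L]
    [IsScalarTower K⟦X⟧ O L] [Module.Finite (LaurentSeries K) L] :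
    Module.Finite K (O ⧸ Ideal.span {algebraMap K⟦X⟧ O PowerSeries.X}) := by
  set s := algebraMap K⟦X⟧ O PowerSeries.X with hs
  have injRL : Function.Injective (algebraMap K⟦X⟧ L) := by
    rw [IsScalarTower.algebraMap_eq K⟦X⟧ (LaurentSeries K) L]
    exact (algebraMap (LaurentSeries K) L).injective.comp
      (IsFractionRing.injective K⟦X⟧ (LaurentSeries K))
  have hs0 : s ≠ 0 := by
    intro h
    have : algebraMap K⟦X⟧ L PowerSeries.X = 0 := by
      rw [IsScalarTower.algebraMap_apply K⟦X⟧ O L, ← hs, h, map_zero]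
    exact PowerSeries.X_ne_zero ((map_eq_zero_iff _ injRL).1 this)
  let b := Module.Basis.ofVectorSpace K (O ⧸ Ideal.span {s})
  choose u hu using fun i => Ideal.Quotient.mk_surjective (b i)
  have hc : ∀ c : K⟦X⟧, Ideal.Quotient.mk (Ideal.span {s}) (algebraMap K⟦X⟧ O c) =
      algebraMap K _ (constantCoeff c) := by
    intro c
    have : PowerSeries.X ∣ c - algebraMap K K⟦X⟧ (PowerSeries.constantCoeff c) := by
      rw [PowerSeries.X_dvd_iff]; simp
    obtain ⟨e, he⟩ := this
    rw [sub_eq_iff_eq_add] at he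
    conv_lhs => rw [he, map_add, map_mul, ← hs, ← IsScalarTower.algebraMap_apply]
    rw [map_add]
    rw [Ideal.Quotient.eq_zero_iff_mem.2 (Ideal.mul_mem_right _ _ (Ideal.mem_span_singleton_self s)), zero_add]
    rfl
  have hlin : LinearIndependent K⟦X⟧ u := by
    rw [linearIndependent_iff']
    intro t
    have key : ∀ k : ℕ, ∀ c : _ → K⟦X⟧, ∑ i ∈ t, c i • u i = 0 → ∀ i ∈ t, coeff k (c i) = 0 := by
      intro k
      have base : ∀ c : _ → K⟦X⟧, ∑ i ∈ t, c i • u i = 0 → ∀ i ∈ t, constantCoeff (c i) = 0 := by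
        intro c h
        have h1 := congrArg (Ideal.Quotient.mk (Ideal.span {s})) h
        simp only [map_sum, Algebra.smul_def, map_mul, hc, hu, map_zero] at h1
        simp only [← Algebra.smul_def] at h1
        exact linearIndependent_iff'.1 b.linearIndependent t (fun i => constantCoeff (c i)) h1
      induction k with
      | zero => simpa using base
      | succ k ih =>
        intro c h
        have hb := base c h
        have : ∀ i, ∃ e, i ∈ t → c i = PowerSeries.X * e := by
          intro i
          by_cases hi : i ∈ t
          · obtain ⟨e, he⟩ := PowerSeries.X_dvd_iff.2 (hb i hi)
            exact ⟨e, fun _ => he⟩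
          · exact ⟨0, fun h => (hi h).elim⟩
        choose e he using this
        have : ∑ i ∈ t, e i • u i = 0 := by
          apply mul_left_cancel₀ hs0
          rw [mul_zero, ← h, Finset.mul_sum]
          apply Finset.sum_congr rfl
          intro i hi
          rw [he i hi, Algebra.smul_def, Algebra.smul_def, map_mul, hs, mul_assoc]
        intro i hi
        rw [he i hi, coeff_succ_X_mul]
        exact ih e this i hi
    intro c h i hi
    ext k
    simpa using key k c h i hi
  have hlinL : LinearIndependent K⟦X⟧ (fun i => algebraMap O L (u i)) :=
    hlin.map' ((IsScalarTower.toAlgHom K⟦X⟧ O L).toLinearMap)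
      (LinearMap.ker_eq_bot.2 (FaithfulSMul.algebraMap_injective O L))
  have hlinF := (LinearIndependent.iff_fractionRing K⟦X⟧ (LaurentSeries K)).1 hlinL
  have := hlinF.finite
  exact Module.Finite.of_basis b

end Val

section Val2
open PowerSeries

theorem exists_embedding_aux {K O L : Type*} [Field K] [IsAlgClosed K] [CommRing O] [IsDomain O]
    [ValuationRing O]
    [Algebra K O] [Algebra K⟦X⟧ O] [IsScalarTower K K⟦X⟧ O] [Field L] [Algebra O L]
    [FaithfulSMul O L]
    [Algebra (LaurentSeries K) L] [Algebra K⟦X⟧ L] [IsScalarTower K⟦X⟧ (LaurentSeries K) L]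
    [IsScalarTower K⟦X⟧ O L] [Module.Finite (LaurentSeries K) L]
    (hsm : algebraMap K⟦X⟧ O PowerSeries.X ∈ IsLocalRing.maximalIdeal O) :
    ∃ ψ : O →ₐ[K] K⟦X⟧, Function.Injective ψ ∧
      PowerSeries.constantCoeff (ψ (algebraMap K⟦X⟧ O PowerSeries.X)) = 0 := by
  have hfin := finite_quot (K := K) (O := O) (L := L)
  set s := algebraMap K⟦X⟧ O PowerSeries.X with hs
  have injRL : Function.Injective (algebraMap K⟦X⟧ L) := by
    rw [IsScalarTower.algebraMap_eq K⟦X⟧ (LaurentSeries K) L]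
    exact (algebraMap (LaurentSeries K) L).injective.comp
      (IsFractionRing.injective K⟦X⟧ (LaurentSeries K))
  have injRO : Function.Injective (algebraMap K⟦X⟧ O) := by
    have := IsScalarTower.algebraMap_eq K⟦X⟧ O L
    rw [this] at injRL
    exact Function.Injective.of_comp injRL
  have hs0 : s ≠ 0 := by
    rw [hs, Ne, map_eq_zero_iff _ injRO]
    exact PowerSeries.X_ne_zero
  set Q := O ⧸ Ideal.span {s} with hQ
  have hart : IsArtinianRing Q := IsArtinianRing.of_finite K Q
  have hle : Ideal.span {s} ≤ IsLocalRing.maximalIdeal O := by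
    rwa [Ideal.span_singleton_le_iff_mem]
  -- the maximal ideal is principal
  have hfg : (IsLocalRing.maximalIdeal O).FG := by
    apply Ideal.fg_of_fg_map_of_fg_inf_ker_of_surjective (f := Ideal.Quotient.mk (Ideal.span {s}))
    · exact IsNoetherian.noetherian _
    · rw [Ideal.mk_ker, inf_eq_right.2 hle]
      exact ⟨{s}, by simp⟩
    · exact Ideal.Quotient.mk_surjective
  have hprin : (IsLocalRing.maximalIdeal O).IsPrincipal :=
    IsBezout.isPrincipal_of_FG _ hfg
  obtain ⟨π, hπ⟩ := hprin
  have hπm : π ∈ IsLocalRing.maximalIdeal O := by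
    rw [hπ]; exact Ideal.mem_span_singleton_self π
  have hπ0 : π ≠ 0 := by
    rintro rfl
    rw [hπ] at hsm
    simp at hsm
    exact hs0 hsm
  -- residue field
  have hfin2 : Module.Finite K (O ⧸ IsLocalRing.maximalIdeal O) :=
    Module.Finite.of_surjective (Ideal.Quotient.factorₐ K hle).toLinearMap
      (Ideal.Quotient.factor_surjective hle)
  have hbij : Function.Bijective (algebraMap K (O ⧸ IsLocalRing.maximalIdeal O)) :=
    IsAlgClosed.algebraMap_bijective_of_isIntegral
  let e : K ≃ₐ[K] (O ⧸ IsLocalRing.maximalIdeal O) :=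
    AlgEquiv.ofBijective (Algebra.ofId K _) hbij
  let ρ : O →ₐ[K] K := e.symm.toAlgHom.comp (Ideal.Quotient.mkₐ K _)
  have hρ : ∀ f, ρ f = 0 ↔ π ∣ f := by
    intro f
    rw [← Ideal.mem_span_singleton]
    change e.symm (Ideal.Quotient.mk _ f) = 0 ↔ f ∈ Submodule.span O {π}
    rw [← hπ, map_eq_zero_iff _ e.symm.injective, Ideal.Quotient.eq_zero_iff_mem]
  obtain ⟨ψ, hψπ, hψc⟩ := exists_expansion ρ π hπ0 hρ
  -- nilpotence
  have hnil : ∃ n a, π ^ n = s * a := by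
    have h1 : IsNilpotent (Ideal.Quotient.mk (Ideal.span {s}) π) := by
      rw [← mem_nilradical, nilradical, Ideal.radical_eq_sInf, Ideal.mem_sInf]
      rintro J ⟨-, hJ⟩
      have hJm : J.IsMaximal := IsArtinianRing.isPrime_iff_isMaximal J |>.1 hJ
      have h2 := Ideal.comap_isMaximal_of_surjective (Ideal.Quotient.mk (Ideal.span {s}))
        Ideal.Quotient.mk_surjective (K := J)
      have h3 := IsLocalRing.eq_maximalIdeal h2
      have : π ∈ J.comap (Ideal.Quotient.mk (Ideal.span {s})) := h3 ▸ hπm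
      exact this
    obtain ⟨n, hn⟩ := h1
    rw [← map_pow, Ideal.Quotient.eq_zero_iff_mem, Ideal.mem_span_singleton] at hn
    exact ⟨n, hn⟩
  have hψs : ψ s ≠ 0 := by
    obtain ⟨n, a, hn⟩ := hnil
    intro h
    have := congrArg ψ hn
    rw [map_pow, map_mul, h, zero_mul, hψπ] at this
    exact pow_ne_zero n PowerSeries.X_ne_zero this
  refine ⟨ψ, ?_, ?_⟩
  · rw [injective_iff_map_eq_zero]
    intro f hf
    by_contra hf0
    have halgF : Algebra.IsAlgebraic (LaurentSeries K) L := inferInstance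
    have halgR : Algebra.IsAlgebraic K⟦X⟧ L :=
      (IsFractionRing.comap_isAlgebraic_iff (A := K⟦X⟧) (K := LaurentSeries K)).2 halgF
    have hfa : IsAlgebraic K⟦X⟧ f := by
      have := halgR.isAlgebraic (algebraMap O L f)
      exact (isAlgebraic_algebraMap_iff (FaithfulSMul.algebraMap_injective O L)).1 this
    obtain ⟨r, hr0, g, hg⟩ :=
      hfa.exists_nonzero_dvd (mem_nonZeroDivisors_of_ne_zero hf0)
    have hr1 : ψ (algebraMap K⟦X⟧ O r) = 0 := by rw [hg, map_mul, hf, zero_mul]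
    obtain ⟨k, u, hu⟩ : ∃ k : ℕ, ∃ u : K⟦X⟧ˣ, r = PowerSeries.X ^ k * u.val := by
      obtain ⟨k, u, hu⟩ := IsDiscreteValuationRing.eq_unit_mul_pow_irreducible hr0
        (PowerSeries.X_irreducible (R := K))
      exact ⟨k, u, by rw [hu, mul_comm]⟩
    rw [hu, map_mul, map_pow, map_mul, map_pow, ← hs] at hr1
    have hunit : IsUnit (ψ (algebraMap K⟦X⟧ O u.val)) :=
      (u.isUnit.map (algebraMap K⟦X⟧ O)).map ψ
    exact mul_ne_zero (pow_ne_zero k hψs) hunit.ne_zero hr1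
  · rw [hψc, hρ, ← Ideal.mem_span_singleton]
    change s ∈ Submodule.span O {π}
    rwa [← hπ]

theorem algebraMap_laurent {K : Type*} [Field K] (c : K) :
    algebraMap K (LaurentSeries K) c =
      algebraMap K⟦X⟧ (LaurentSeries K) (algebraMap K K⟦X⟧ c) := by
  rfl

theorem exists_embedding {K L : Type*} [Field K] [IsAlgClosed K] [Field L]
    [Algebra (LaurentSeries K) L] [Module.Finite (LaurentSeries K) L] :
    ∃ Ψ : L →+* LaurentSeries K,
      (∀ c : K, Ψ (algebraMap (LaurentSeries K) L (algebraMap K _ c)) = algebraMap K _ c) ∧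
      ∃ w : K⟦X⟧, PowerSeries.constantCoeff w = 0 ∧
        Ψ (algebraMap (LaurentSeries K) L (algebraMap K⟦X⟧ _ PowerSeries.X)) =
          algebraMap K⟦X⟧ (LaurentSeries K) w := by
  let i : K⟦X⟧ →+* L := (algebraMap (LaurentSeries K) L).comp (algebraMap K⟦X⟧ (LaurentSeries K))
  have hi : Function.Injective i := (algebraMap (LaurentSeries K) L).injective.comp
      (IsFractionRing.injective K⟦X⟧ (LaurentSeries K))
  let e : K⟦X⟧ ≃+* i.range := RingEquiv.ofLeftInverse (Function.leftInverse_invFun hi)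
  have hne : Ideal.span {e PowerSeries.X} ≠ ⊤ := by
    rw [Ne, Ideal.span_singleton_eq_top]
    intro h
    have := h.map e.symm
    rw [e.symm_apply_apply] at this
    exact PowerSeries.X_prime.not_isUnit this
  obtain ⟨B, hB1, hB2⟩ := Ideal.image_subset_nonunits_valuationSubring _ hne
  let j : K⟦X⟧ →+* B := i.codRestrict B.toSubring fun r => hB1 ⟨r, rfl⟩
  let _ : Algebra K⟦X⟧ L := i.toAlgebra
  let _ : Algebra K⟦X⟧ B := j.toAlgebra
  let _ : Algebra K B := (j.comp (algebraMap K K⟦X⟧)).toAlgebra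
  have : IsScalarTower K K⟦X⟧ B := IsScalarTower.of_algebraMap_eq fun x => rfl
  have : IsScalarTower K⟦X⟧ (LaurentSeries K) L := IsScalarTower.of_algebraMap_eq fun x => rfl
  have : IsScalarTower K⟦X⟧ B L := IsScalarTower.of_algebraMap_eq fun x => rfl
  have hm : algebraMap K⟦X⟧ B PowerSeries.X ∈ IsLocalRing.maximalIdeal B := by
    have h1 : i PowerSeries.X ∈ B.nonunits :=
      hB2 ⟨e PowerSeries.X, Ideal.mem_span_singleton_self _, rfl⟩
    rw [← SetLike.mem_coe, ← B.image_maximalIdeal] at h1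
    obtain ⟨y, hy, hy2⟩ := h1
    have : y = algebraMap K⟦X⟧ B PowerSeries.X := Subtype.ext hy2
    exact this ▸ hy
  obtain ⟨ψ, hψ, hψ0⟩ := exists_embedding_aux (K := K) (O := B) (L := L) hm
  have hinj : Function.Injective ((algebraMap K⟦X⟧ (LaurentSeries K)).comp ψ.toRingHom) :=
    (IsFractionRing.injective K⟦X⟧ (LaurentSeries K)).comp hψ
  let Ψ : L →+* LaurentSeries K := IsFractionRing.lift hinj
  have hΨ : ∀ b : B, Ψ (b : L) = algebraMap K⟦X⟧ (LaurentSeries K) (ψ b) :=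
    fun b => IsFractionRing.lift_algebraMap hinj b
  refine ⟨Ψ, ?_, _, hψ0, ?_⟩
  · intro c
    have h1 := hΨ (algebraMap K B c)
    rw [ψ.commutes, ← algebraMap_laurent] at h1
    refine Eq.trans (congrArg Ψ ?_) h1
    rw [algebraMap_laurent]
    rfl
  · exact hΨ (algebraMap K⟦X⟧ B PowerSeries.X)

end Val2

theorem laurentX_inv_transcendental {K : Type*} [Field K] :
    Transcendental K (algebraMap (PowerSeries K) (LaurentSeries K) PowerSeries.X)⁻¹ := by
  intro h
  have h2 := h.inv
  rw [inv_inv] at h2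
  obtain ⟨p, hp0, hp⟩ := h2
  apply hp0
  have : ∀ q : Polynomial K, Polynomial.aeval
      (algebraMap (PowerSeries K) (LaurentSeries K) PowerSeries.X) q =
      algebraMap (PowerSeries K) (LaurentSeries K) (q : PowerSeries K) := by
    intro q
    rw [← Polynomial.eval₂_C_X_eq_coe, Polynomial.hom_eval₂, Polynomial.aeval_def]
    congr 1
  rw [this, map_eq_zero_iff _ (IsFractionRing.injective _ _)] at hp
  exact_mod_cast hp

theorem exists_laurent_point {K : Type*} [Field K] [IsAlgClosed K] {n : ℕ}
    (I : Ideal (MvPolynomial (Fin n) K)) (i : Fin n)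
    (hI : ∀ p : Polynomial K, Polynomial.aeval (X i : MvPolynomial (Fin n) K) p ∈ I → p = 0) :
    ∃ h : Fin n → LaurentSeries K, (∀ f ∈ I, MvPolynomial.aeval h f = 0) ∧
      ∃ m : ℤ, m < 0 ∧ (h i).coeff m ≠ 0 := by
  let T : LaurentSeries K := algebraMap (PowerSeries K) (LaurentSeries K) PowerSeries.X
  have hT0 : T ≠ 0 := by
    rw [Ne, map_eq_zero_iff _ (IsFractionRing.injective _ _)]
    exact PowerSeries.X_ne_zero
  let x : MvPolynomial (Fin n) K ⧸ I := Ideal.Quotient.mk I (X i)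
  have hx : ∀ p : Polynomial K, Polynomial.aeval x p = Ideal.Quotient.mk I (Polynomial.aeval (X i) p) := by
    intro p
    exact Polynomial.aeval_algHom_apply (Ideal.Quotient.mkₐ K I) (X i) p
  obtain ⟨L, _, _, _, φ, hφ⟩ := exists_field_point (K := K) (P := Polynomial K)
    (A := MvPolynomial (Fin n) K ⧸ I) (F := LaurentSeries K)
    (Polynomial.aeval x) (Polynomial.aeval T⁻¹)
    (by
      rw [injective_iff_map_eq_zero]
      intro p hp
      rw [hx, Ideal.Quotient.eq_zero_iff_mem] at hp
      exact hI p hp)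
    (transcendental_iff_injective.1 laurentX_inv_transcendental)
  obtain ⟨Ψ, hΨK, w, hw0, hw⟩ := exists_embedding (K := K) (L := L)
  let Φ : MvPolynomial (Fin n) K →+* LaurentSeries K :=
    (Ψ.comp φ).comp (Ideal.Quotient.mk I)
  have hΦ : ∀ c, Φ (C c) = algebraMap K _ c := by
    intro c
    have h1 := hφ (Polynomial.C c)
    rw [Polynomial.aeval_C, Polynomial.aeval_C] at h1
    rw [← hΨK c, ← h1]
    rfl
  let Φa : MvPolynomial (Fin n) K →ₐ[K] LaurentSeries K := { Φ with commutes' := hΦ }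
  refine ⟨fun j => Φ (X j), ?_, ?_⟩
  · intro f hf
    have h1 : MvPolynomial.aeval (fun j => Φ (X j)) = Φa := by
      ext j : 1
      rw [MvPolynomial.aeval_X]
      rfl
    rw [h1]
    change Ψ (φ (Ideal.Quotient.mk I f)) = 0
    rw [Ideal.Quotient.eq_zero_iff_mem.2 hf, map_zero, map_zero]
  · have h1 := hφ Polynomial.X
    rw [Polynomial.aeval_X, Polynomial.aeval_X] at h1
    have h2 : Φ (X i) * algebraMap (PowerSeries K) (LaurentSeries K) w = 1 := by
      rw [← hw]
      change Ψ (φ x) * _ = 1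
      rw [h1, ← map_mul, ← map_mul]
      change Ψ (algebraMap _ L (T⁻¹ * T)) = 1
      rw [inv_mul_cancel₀ hT0, map_one, map_one]
    by_contra! hcon
    have h3 : ∃ g : PowerSeries K, algebraMap (PowerSeries K) (LaurentSeries K) g = Φ (X i) := by
      refine ⟨PowerSeries.mk fun k => (Φ (X i)).coeff k, ?_⟩
      ext m
      change (HahnSeries.ofPowerSeries ℤ K _).coeff m = _
      rcases lt_or_ge m 0 with hm | hm
      · rw [hcon m hm, HahnSeries.ofPowerSeries_apply, HahnSeries.embDomain_of_notMem_range]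
        rintro ⟨k, hk⟩
        simp at hk
        omega
      · lift m to ℕ using hm
        rw [HahnSeries.ofPowerSeries_apply_coeff]
        simp
    obtain ⟨g, hg⟩ := h3
    rw [← hg, ← map_mul] at h2
    have h4 : g * w = 1 := by
      apply IsFractionRing.injective (PowerSeries K) (LaurentSeries K)
      rw [h2, map_one]
    have h5 := congrArg PowerSeries.constantCoeff h4
    rw [map_mul, hw0, mul_zero, map_one] at h5
    exact zero_ne_one h5

theorem infinite_of_vdim {K : Type*} [Field K] {n : ℕ} (V : Set (Fin n → K))
    (hVdim : 1 ≤ vdim K n V) : V.Infinite := by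
  intro hfin
  have : T1Space (Fin n → K) := by
    refine ⟨fun x => ?_⟩
    rw [← isOpen_compl_iff]
    apply TopologicalSpace.isOpen_generateFrom_of_mem
    refine ⟨Set.range fun j => X j - C (x j), ?_⟩
    congr 1
    ext y
    simp [_root_.zeroLocus, sub_eq_zero, _root_.funext_iff]
  have : Finite V := hfin
  have h0 := topologicalKrullDim_zero_of_discreteTopology V
  have h1 : (1 : WithBot ℕ∞) ≤ 0 := hVdim.trans h0
  exact absurd h1 (by decide)

theorem exists_coord {K : Type*} [Field K] {n : ℕ} (V : Set (Fin n → K))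
    (hV : V.Infinite) : ∃ i : Fin n, ((fun x : Fin n → K => x i) '' V).Infinite := by
  by_contra! h
  apply hV
  have := Set.Finite.pi' h
  refine this.subset fun x hx i => ⟨x, hx, rfl⟩

theorem laurent_series_solution
    {K : Type*} [Field K] [IsAlgClosed K] {n : ℕ}
    (V : Set (Fin n → K)) (hV : IsAffineVariety K n V)
    (hVdim : 1 ≤ vdim K n V) :
    ∃ h : Fin n → LaurentSeries K,
      (∀ f : MvPolynomial (Fin n) K, (∀ x ∈ V, eval x f = 0) →
        MvPolynomial.aeval h f = 0) ∧
      ∃ i : Fin n, ∃ m : ℤ, m < 0 ∧ (h i).coeff m ≠ 0 := by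
  obtain ⟨i, hi⟩ := exists_coord V (infinite_of_vdim V hVdim)
  obtain ⟨h, h1, m, hm⟩ := exists_laurent_point (_root_.vanishingIdeal K n V) i (by
    intro p hp
    refine Polynomial.eq_zero_of_infinite_isRoot p (hi.mono ?_)
    rintro _ ⟨x, hx, rfl⟩
    have h2 : eval x (Polynomial.aeval (X i : MvPolynomial (Fin n) K) p) = 0 := hp x hx
    have h3 := Polynomial.aeval_algHom_apply (MvPolynomial.aeval x : _ →ₐ[K] K)
      (X i : MvPolynomial (Fin n) K) p
    rw [MvPolynomial.aeval_X] at h3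
    have h4 : MvPolynomial.aeval x (Polynomial.aeval (X i : MvPolynomial (Fin n) K) p) = 0 := h2
    rw [h4] at h3
    simpa [Polynomial.IsRoot] using h3)
  exact ⟨h, fun f hf => h1 f hf, i, m, hm⟩
end

section
/- Let V ⊆ 𝔽̄^n be an affine variety of dimension k < n and degree d. Then for every subset J ⊆ {1,…,n} of size k+1 there exists a nonzero polynomial f ∈ 𝔽̄[x_j : j ∈ J] (a polynomial depending only on the variables indexed by J) of degree at most d that vanishes identically on V. -/
open MvPolynomial

set_option linter.unusedSectionVars false
set_option linter.style.haveILetI false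

section liftlemma

variable {K R A : Type*} [Field K] [IsAlgClosed K] [CommRing R] [IsDomain R] [IsIntegrallyClosed R]
  [CommRing A] [IsDomain A] [Algebra K R] [Algebra K A] [Algebra R A] [IsScalarTower K R A]
  [FaithfulSMul R A]

theorem pp_dvd_of_root (y : A) (F : Polynomial R) (hF : F.Monic) (hirr : Irreducible F)
    (hFy : Polynomial.aeval y F = 0) (p : Polynomial R) (hp : Polynomial.aeval y p = 0) : F ∣ p := by
  have hy : IsIntegral R y := ⟨F, hF, hFy⟩
  have : Module.IsTorsionFree R A := by
    infer_instance
  have h1 : minpoly R y ∣ F := minpoly.isIntegrallyClosed_dvd hy hFy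
  have h2 : minpoly R y ∣ p := minpoly.isIntegrallyClosed_dvd hy hp
  have h3 : ¬ IsUnit (minpoly R y) := minpoly.not_isUnit R y
  exact ((hirr.dvd_iff.1 h1).resolve_left h3).dvd.trans h2

theorem pp_exists_lift [Algebra.FiniteType K A] (y : A) (F : Polynomial R) (hF : F.Monic)
    (hirr : Irreducible F)
    (hFy : Polynomial.aeval y F = 0) (c : R) (G : Set A) (hG : Algebra.adjoin K G = ⊤)
    (hc : ∀ z ∈ G, IsIntegral R (c • z)) (a : R →ₐ[K] K) (hac : a c ≠ 0) (y0 : K)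
    (hy0 : (F.map (a : R →+* K)).eval y0 = 0) :
    ∃ φ : A →ₐ[K] K, (∀ r, φ (algebraMap R A r) = a r) ∧ φ y = y0 := by
  have hy : IsIntegral R y := ⟨F, hF, hFy⟩
  let B := integralClosure R A
  let yB : B := ⟨y, hy⟩
  let j : Polynomial R →+* B := (Polynomial.aeval yB : Polynomial R →ₐ[R] B)
  let ψ : Polynomial R →+* K := Polynomial.eval₂RingHom (a : R →+* K) y0
  letI := j.toAlgebra
  have : IsScalarTower R (Polynomial R) B := IsScalarTower.of_algebraMap_eq (fun r => by
    change _ = Polynomial.aeval yB (Polynomial.C r)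
    simp)
  have : Algebra.IsIntegral (Polynomial R) B := Algebra.IsIntegral.tower_top (R := R)
  have hker : RingHom.ker (algebraMap (Polynomial R) B) ≤ RingHom.ker ψ := by
    intro p hp
    have hp1 : Polynomial.aeval yB p = 0 := hp
    have hp2 : Polynomial.aeval y p = 0 := by
      have := congrArg (algebraMap B A) hp1
      rwa [← Polynomial.aeval_algebraMap_apply, map_zero] at this
    obtain ⟨q, rfl⟩ := pp_dvd_of_root y F hF hirr hFy p hp2
    rw [RingHom.mem_ker, map_mul]
    have : ψ F = 0 := by
      rw [Polynomial.eval_map] at hy0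
      exact hy0
    rw [this, zero_mul]
  have hψp : (RingHom.ker ψ).IsPrime := RingHom.ker_isPrime ψ
  obtain ⟨Q, hQ, hQc⟩ := Ideal.exists_ideal_over_prime_of_isIntegral_of_isDomain
    (RingHom.ker ψ) hker
  have memQ : ∀ p, ψ p = 0 → j p ∈ Q := fun p hp => by
    have : p ∈ Ideal.comap (algebraMap (Polynomial R) B) Q := by rw [hQc]; exact hp
    exact this
  have memQ' : ∀ p, j p ∈ Q → ψ p = 0 := fun p hp => by
    have : p ∈ Ideal.comap (algebraMap (Polynomial R) B) Q := hp
    rw [hQc] at this; exact this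
  have hjC : ∀ r, j (Polynomial.C r) = algebraMap R B r := fun r => by
    change Polynomial.aeval yB (Polynomial.C r) = _
    simp
  have hfrac : ∀ z : A, ∃ N : ℕ, ∃ b : B, algebraMap R A c ^ N * z = b := by
    intro z
    have hz : z ∈ Algebra.adjoin K G := by rw [hG]; trivial
    induction hz using Algebra.adjoin_induction with
    | mem x hx =>
      refine ⟨1, ⟨c • x, hc x hx⟩, ?_⟩
      simp [Algebra.smul_def]
    | algebraMap r =>
      refine ⟨0, algebraMap R B (algebraMap K R r), ?_⟩
      rw [pow_zero, one_mul, IsScalarTower.algebraMap_apply K R A]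
      rfl
    | add x z _ _ hx hz =>
      obtain ⟨N, b, hb⟩ := hx
      obtain ⟨N', b', hb'⟩ := hz
      refine ⟨N + N', algebraMap R B c ^ N' * b + algebraMap R B c ^ N * b', ?_⟩
      push_cast
      rw [← hb, ← hb']
      change _ = algebraMap R A c ^ N' * _ + algebraMap R A c ^ N * _
      ring
    | mul x z _ _ hx hz =>
      obtain ⟨N, b, hb⟩ := hx
      obtain ⟨N', b', hb'⟩ := hz
      refine ⟨N + N', b * b', ?_⟩
      push_cast
      rw [← hb, ← hb']
      ring
  have hmap : ∀ x ∈ Ideal.map (algebraMap B A) Q, ∃ N : ℕ, ∃ q ∈ Q, algebraMap R A c ^ N * x = (q : B) := by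
    intro x hx
    induction hx using Submodule.span_induction with
    | mem x hx =>
      obtain ⟨q, hq, rfl⟩ := hx
      exact ⟨0, q, hq, by simp⟩
    | zero => exact ⟨0, 0, Q.zero_mem, by simp⟩
    | add x z _ _ hx hz =>
      obtain ⟨N, b, hq, hb⟩ := hx
      obtain ⟨N', b', hq', hb'⟩ := hz
      refine ⟨N + N', algebraMap R B c ^ N' * b + algebraMap R B c ^ N * b',
        Q.add_mem (Q.mul_mem_left _ hq) (Q.mul_mem_left _ hq'), ?_⟩
      push_cast
      rw [← hb, ← hb']
      change _ = algebraMap R A c ^ N' * _ + algebraMap R A c ^ N * _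
      ring
    | smul z x _ hx =>
      obtain ⟨N, b, hq, hb⟩ := hx
      obtain ⟨N', b', hb'⟩ := hfrac z
      refine ⟨N + N', b' * b, Q.mul_mem_left _ hq, ?_⟩
      push_cast
      rw [← hb, ← hb', smul_eq_mul]
      ring
  have hne : Ideal.map (algebraMap B A) Q ≠ ⊤ := by
    intro h
    obtain ⟨N, q, hq, hqc⟩ := hmap 1 (by rw [h]; trivial)
    have : q = j (Polynomial.C c ^ N) := by
      apply Subtype.ext
      rw [map_pow, hjC, ← hqc]
      simp
    rw [this] at hq
    have := memQ' _ hq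
    rw [map_pow] at this
    have h2 : ψ (Polynomial.C c) = a c := by simp [ψ]
    rw [h2] at this
    exact hac (pow_eq_zero_iff (n := N) (by rintro rfl; simp at this) |>.1 this)
  obtain ⟨M, hM, hQM⟩ := Ideal.exists_le_maximal _ hne
  let : Field (A ⧸ M) := Ideal.Quotient.field M
  have : Module.Finite K (A ⧸ M) := finite_of_finite_type_of_isJacobsonRing K (A ⧸ M)
  have hbij := IsAlgClosed.algebraMap_bijective_of_isIntegral (k := K) (K := A ⧸ M)
  let e : K ≃ₐ[K] (A ⧸ M) := AlgEquiv.ofBijective (Algebra.ofId K (A ⧸ M)) hbij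
  have key : ∀ p : Polynomial R, ∀ k : K, ψ p = k →
      e.symm (Ideal.Quotient.mkₐ K M (Polynomial.aeval y p)) = k := by
    intro p k hk
    rw [AlgEquiv.symm_apply_eq, ← sub_eq_zero]
    have h1 : e k = Ideal.Quotient.mkₐ K M (algebraMap K A k) := by
      rw [AlgHom.commutes]; rfl
    rw [h1, ← map_sub]
    refine Ideal.Quotient.eq_zero_iff_mem.2 (hQM ?_)
    have h2 : j (p - Polynomial.C (algebraMap K R k)) ∈ Q := by
      apply memQ
      rw [map_sub, hk]
      simp [ψ]
    have h3 := Ideal.mem_map_of_mem (algebraMap B A) h2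
    convert h3 using 1
    rw [map_sub, hjC, map_sub]
    congr 1
    · change _ = algebraMap B A (Polynomial.aeval yB p)
      rw [← Polynomial.aeval_algebraMap_apply]; rfl
    · rw [IsScalarTower.algebraMap_apply K R A]; rfl
  refine ⟨(e.symm : (A ⧸ M) →ₐ[K] K).comp (Ideal.Quotient.mkₐ K M), fun r => ?_, ?_⟩
  · have := key (Polynomial.C r) (a r) (by simp [ψ])
    rwa [Polynomial.aeval_C] at this
  · have := key Polynomial.X y0 (by simp [ψ])
    rwa [Polynomial.aeval_X] at this

theorem pp_fiber_finite (G : Set A) (hGf : G.Finite) (hG : Algebra.adjoin K G = ⊤) (a : R →ₐ[K] K)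
    (p : A → Polynomial R) (hp : ∀ z ∈ G, Polynomial.aeval z (p z) = 0)
    (hpa : ∀ z ∈ G, (p z).map (a : R →+* K) ≠ 0) :
    {φ : A →ₐ[K] K | ∀ r, φ (algebraMap R A r) = a r}.Finite := by
  have := hGf.to_subtype
  have hfin : (Set.pi Set.univ (fun z : G => {k : K | ((p z).map (a : R →+* K)).eval k = 0})).Finite := by
    apply Set.Finite.pi
    intro z
    have := hpa z z.2
    apply (Polynomial.finite_setOfPred_isRoot this).subset
    intro k hk
    exact hk
  refine Set.Finite.of_finite_image (f := fun φ (z : G) => φ z) (hfin.subset ?_) ?_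
  · rintro _ ⟨φ, hφ, rfl⟩ z -
    have h1 := congrArg φ (hp z z.2)
    rw [map_zero, Polynomial.aeval_def] at h1
    change (φ : A →+* K) _ = 0 at h1
    rw [Polynomial.hom_eval₂] at h1
    simp only [Set.mem_ofPred_eq, Polynomial.eval_map]
    rw [← h1]
    congr 1
    ext r
    exact (hφ r).symm
  · intro φ _ χ _ h
    refine AlgHom.ext_of_adjoin_eq_top hG (fun z hz => congrFun h ⟨z, hz⟩)

theorem pp_resultant (F : Polynomial R) (hF : F.Monic) (hirr : Irreducible F)
    (hder : Polynomial.derivative F ≠ 0) : ∃ r : R, r ≠ 0 ∧ ∀ a : R →+* K, a r ≠ 0 →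
      (F.map a).Separable := by
  let L := FractionRing R
  let F' := Polynomial.derivative F
  refine ⟨Polynomial.resultant F F' F.natDegree F'.natDegree, ?_, ?_⟩
  · have hL : Irreducible (F.map (algebraMap R L)) :=
      (hF.irreducible_iff_irreducible_map_fraction_map).1 hirr
    have hinj : Function.Injective (algebraMap R L) := IsFractionRing.injective R L
    have hs : (F.map (algebraMap R L)).Separable := by
      rw [Polynomial.separable_iff_derivative_ne_zero hL, Polynomial.derivative_map]
      exact (Polynomial.map_ne_zero_iff hinj).2 hder
    have := Polynomial.resultant_ne_zero _ _ hs
    rw [Polynomial.derivative_map, Polynomial.natDegree_map_eq_of_injective hinj,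
      Polynomial.natDegree_map_eq_of_injective hinj, Polynomial.resultant_map_map] at this
    intro h
    exact this (by rw [h, map_zero])
  · intro a ha
    rw [← Polynomial.resultant_map_map] at ha
    have hm : (F.map a).natDegree = F.natDegree := hF.natDegree_map a
    obtain ⟨k, hk⟩ := Nat.exists_eq_add_of_le (Polynomial.natDegree_map_le (f := a) (p := F'))
    rw [hk, ← hm, Polynomial.resultant_add_right_deg _ _ _ _ _ le_rfl] at ha
    rw [Polynomial.Separable, Polynomial.derivative_map]
    by_contra hcop
    have := right_ne_zero_of_mul ha
    apply this
    rw [Polynomial.resultant_eq_zero_iff]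
    exact ⟨Or.inl (hF.map a).ne_zero, hcop⟩

end liftlemma

theorem pp_fiber {K A T : Type*} [Field K] [IsAlgClosed K] [Finite T] [CommRing A] [IsDomain A]
    [Algebra K A] [Algebra.FiniteType K A] (τ : T → A) (hτ : IsTranscendenceBasis K τ) (y : A)
    (F : Polynomial (MvPolynomial T K)) (hF : F.Monic) (hirr : Irreducible F)
    (hder : Polynomial.derivative F ≠ 0)
    (hFy : F.eval₂ ((aeval τ : MvPolynomial T K →ₐ[K] A) : MvPolynomial T K →+* A) y = 0) :
    ∃ a : T → K, {φ : A →ₐ[K] K | ∀ s, φ (τ s) = a s}.Finite ∧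
      F.natDegree ≤ {φ : A →ₐ[K] K | ∀ s, φ (τ s) = a s}.ncard := by
  classical
  let R := MvPolynomial T K
  letI : Algebra R A := ((aeval τ : MvPolynomial T K →ₐ[K] A) : R →+* A).toAlgebra
  have hmap : ∀ r : R, algebraMap R A r = aeval τ r := fun r => rfl
  have : IsScalarTower K R A := IsScalarTower.of_algebraMap_eq (fun k => by
    rw [hmap, AlgHom.commutes])
  have hinj : Function.Injective (algebraMap R A) := hτ.1
  have : FaithfulSMul R A := (faithfulSMul_iff_algebraMap_injective R A).2 hinj
  have halg : Algebra.IsAlgebraic R A := by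
    have h1 := hτ.isAlgebraic
    refine ⟨fun z => ?_⟩
    refine (isAlgebraic_ringHom_iff_of_comp_eq (R := R) (S := Algebra.adjoin K (Set.range τ))
      (A := A) (B := A) (hτ.1.aevalEquiv) (RingHom.id A) (fun _ _ h => h) ?_).1 (h1.1 z)
    ext r
    · have h3 : algebraMap R A (C r) = algebraMap K A r := by
        rw [hmap]; exact aeval_C _ _
      simpa using h3.symm
    · simp [hmap]
  obtain ⟨G, hG⟩ := (Algebra.FiniteType.out : (⊤ : Subalgebra K A).FG)
  obtain ⟨c, hc0, hc⟩ := Algebra.IsAlgebraic.exists_integral_multiples R G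
  have hp : ∀ z : A, ∃ p : Polynomial R, p ≠ 0 ∧ Polynomial.aeval z p = 0 := fun z => halg.1 z
  choose p hp0 hp using hp
  obtain ⟨r, hr0, hr⟩ := pp_resultant (K := K) F hF hirr hder
  have hprod : c * r * ∏ z ∈ G, (p z).leadingCoeff ≠ 0 := by
    refine mul_ne_zero (mul_ne_zero hc0 hr0) (Finset.prod_ne_zero_iff.2 fun z _ => ?_)
    exact Polynomial.leadingCoeff_ne_zero.2 (hp0 z)
  obtain ⟨a, ha⟩ : ∃ a : T → K, eval a (c * r * ∏ z ∈ G, (p z).leadingCoeff) ≠ 0 := by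
    by_contra! h
    exact hprod (MvPolynomial.funext (fun x => by rw [h x, map_zero]))
  rw [map_mul, map_mul, map_prod] at ha
  have hac := left_ne_zero_of_mul (left_ne_zero_of_mul ha)
  have har := right_ne_zero_of_mul (left_ne_zero_of_mul ha)
  have hap := Finset.prod_ne_zero_iff.1 (right_ne_zero_of_mul ha)
  let ea : R →ₐ[K] K := aeval a
  have hea : ∀ q : R, ea q = eval a q := fun q => by
    change aeval a (q : MvPolynomial T K) = _
    rw [aeval_eq_eval]
  have hset : {φ : A →ₐ[K] K | ∀ s, φ (τ s) = a s} =
      {φ : A →ₐ[K] K | ∀ r : R, φ (algebraMap R A r) = ea r} := by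
    ext φ
    constructor
    · intro h q
      have h2 : φ.comp (aeval τ) = ea := by
        ext s
        simpa [ea] using h s
      exact DFunLike.congr_fun h2 q
    · intro h s
      have := h (X s)
      have h3 : ea (X s) = a s := aeval_X _ _
      rw [hmap, h3] at this
      have h4 : aeval τ (X s : MvPolynomial T K) = τ s := aeval_X _ _
      rw [← h4]
      exact this
  have hfin := pp_fiber_finite (K := K) (R := R) (G : Set A) G.finite_toSet hG ea p
    (fun z _ => hp z) (fun z hz h => hap z hz (by
      have := congrArg (fun q => Polynomial.coeff q (p z).natDegree) h
      simp only [Polynomial.coeff_map, Polynomial.coeff_zero] at this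
      rw [← hea]
      exact this))
  refine ⟨a, hset ▸ hfin, ?_⟩
  rw [hset]
  let Fa := F.map (ea : R →+* K)
  have hsep : Fa.Separable := hr (ea : R →+* K) (by
    change ea r ≠ 0
    rw [hea]; exact har)
  have hFa : Fa.natDegree = F.natDegree := hF.natDegree_map _
  have hFam : Fa.Monic := hF.map _
  have hlift : ∀ y0 ∈ Fa.roots.toFinset, ∃ φ : A →ₐ[K] K,
      (∀ r, φ (algebraMap R A r) = ea r) ∧ φ y = y0 := by
    intro y0 hy0
    rw [Multiset.mem_toFinset, Polynomial.mem_roots hFam.ne_zero] at hy0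
    exact pp_exists_lift y F hF hirr hFy c (G : Set A) hG hc ea
      (by rw [hea]; exact hac) y0 hy0
  have hcard : Fa.roots.toFinset.card = F.natDegree := by
    rw [Multiset.toFinset_card_of_nodup (Polynomial.nodup_roots hsep), ← hFa]
    exact (IsAlgClosed.splits Fa).natDegree_eq_card_roots.symm
  rw [← hcard, ← Set.ncard_coe_finset]
  refine (Set.ncard_le_ncard (t := (fun φ : A →ₐ[K] K => φ y) ''
    {φ : A →ₐ[K] K | ∀ r : R, φ (algebraMap R A r) = ea r}) ?_ (hfin.image _)).trans
    (Set.ncard_image_le hfin)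
  intro y0 hy0
  obtain ⟨φ, h1, h2⟩ := hlift y0 hy0
  exact ⟨φ, h1, h2⟩

theorem pp_coeff_prod {K R σ : Type*} [Field K] [CommRing R] [Algebra K R]
    (v : σ → Polynomial R) (β : σ → K) (hv : ∀ i, (v i).natDegree ≤ 1)
    (hv1 : ∀ i, (v i).coeff 1 = algebraMap K R (β i)) (m : σ → ℕ) (s : Finset σ) :
    (∏ i ∈ s, v i ^ m i).natDegree ≤ ∑ i ∈ s, m i ∧
    (∏ i ∈ s, v i ^ m i).coeff (∑ i ∈ s, m i) = algebraMap K R (∏ i ∈ s, β i ^ m i) := by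
  classical
  induction s using Finset.induction_on with
  | empty => simp
  | insert a s ha ih =>
    rw [Finset.prod_insert ha, Finset.sum_insert ha, Finset.prod_insert ha]
    have h1 : (v a ^ m a).natDegree ≤ m a := by
      refine Polynomial.natDegree_pow_le.trans ?_
      simpa using Nat.mul_le_mul_left (m a) (hv a)
    refine ⟨Polynomial.natDegree_mul_le.trans (add_le_add h1 ih.1), ?_⟩
    rw [Polynomial.coeff_mul_add_eq_of_natDegree_le h1 ih.1, ih.2, map_mul, map_pow, ← hv1]
    congr 1
    simpa using Polynomial.coeff_pow_of_natDegree_le (m := m a) (hv a)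

theorem pp_coeff_top {K R σ : Type*} [Field K] [CommRing R] [Algebra K R]
    (v : σ → Polynomial R) (β : σ → K) (hv : ∀ i, (v i).natDegree ≤ 1)
    (hv1 : ∀ i, (v i).coeff 1 = algebraMap K R (β i)) (p : MvPolynomial σ K) (e : ℕ)
    (he : p.totalDegree ≤ e) :
    (aeval v p).natDegree ≤ e ∧
    (aeval v p).coeff e = algebraMap K R (eval β (homogeneousComponent e p)) := by
  classical
  have hmono : ∀ m ∈ p.support, (aeval v (monomial m (coeff m p))).natDegree ≤ e ∧
      (aeval v (monomial m (coeff m p))).coeff e =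
        algebraMap K R (if m.degree = e then coeff m p * ∏ i ∈ m.support, β i ^ m i else 0) := by
    intro m hm
    have hme : m.degree ≤ e := (le_totalDegree hm).trans he
    obtain ⟨h1, h2⟩ := pp_coeff_prod v β hv hv1 m m.support
    have h3 : aeval v (monomial m (coeff m p)) =
        Polynomial.C (algebraMap K R (coeff m p)) * ∏ i ∈ m.support, v i ^ m i := by
      rw [aeval_monomial]; rfl
    have h4 : ∑ i ∈ m.support, m i = m.degree := rfl
    rw [h4] at h1 h2
    rw [h3]
    refine ⟨(Polynomial.natDegree_C_mul_le _ _).trans (h1.trans hme), ?_⟩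
    rw [Polynomial.coeff_C_mul]
    split_ifs with h
    · rw [← h, h2, map_mul]
    · rw [Polynomial.coeff_eq_zero_of_natDegree_lt (h1.trans_lt (lt_of_le_of_ne hme h))]
      simp
  have hsum : aeval v p = ∑ m ∈ p.support, aeval v (monomial m (coeff m p)) := by
    conv_lhs => rw [p.as_sum, map_sum]
  constructor
  · rw [hsum]
    exact Polynomial.natDegree_sum_le_of_forall_le _ _ (fun m hm => (hmono m hm).1)
  · rw [hsum, Polynomial.finsetSum_coeff, Finset.sum_congr rfl (fun m hm => (hmono m hm).2),
      homogeneousComponent_apply, Finset.sum_filter, map_sum, map_sum]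
    apply Finset.sum_congr rfl
    intro m _
    split_ifs
    · rw [eval_monomial]; rfl
    · simp

theorem pp_derivative {K R σ : Type*} [Field K] [CommRing R] [Algebra K R] [Fintype σ]
    (v : σ → Polynomial R) (β : σ → K)
    (hv : ∀ i, Polynomial.derivative (v i) = algebraMap K _ (β i)) (p : MvPolynomial σ K) :
    Polynomial.derivative (aeval v p) = aeval v (∑ i, C (β i) * pderiv i p) := by
  classical
  induction p using MvPolynomial.induction_on with
  | C a =>
    have : (aeval v (C a : MvPolynomial σ K)) = Polynomial.C (algebraMap K R a) := by
      rw [aeval_C]; rfl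
    rw [this]
    simp
  | add p q hp hq =>
    simp only [map_add, hp, hq, mul_add, Finset.sum_add_distrib]
  | mul_X p j hp =>
    have h1 : ∑ i, C (β i) * pderiv i (p * X j) = (∑ i, C (β i) * pderiv i p) * X j
        + p * C (β j) := by
      simp only [Derivation.leibniz, pderiv_X, smul_eq_mul, mul_add, Finset.sum_add_distrib]
      rw [add_comm, Finset.sum_mul]
      congr 1
      · exact Finset.sum_congr rfl fun i _ => by ring
      · rw [Finset.sum_eq_single j]
        · simp; ring
        · intro b _ hb; simp [hb.symm]
        · simp
    rw [h1, map_mul, Polynomial.derivative_mul, hp, map_add, map_mul, map_mul, aeval_X, hv, aeval_C]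

theorem pp_lemma2 {K A T : Type*} [Field K] [IsAlgClosed K] [Finite T] [CommRing A] [IsDomain A]
    [Algebra K A] [Algebra.FiniteType K A] (t : T → A) (ht : IsTranscendenceBasis K t) (y : A)
    (f : MvPolynomial (Option T) K) (hirr : Irreducible f) (i0 : Option T) (hder : pderiv i0 f ≠ 0)
    (hf : aeval (fun o : Option T => o.elim y t) f = 0) :
    ∃ b a : T → K, {φ : A →ₐ[K] K | ∀ s, φ (t s) - b s * φ y = a s}.Finite ∧
      f.totalDegree ≤ {φ : A →ₐ[K] K | ∀ s, φ (t s) - b s * φ y = a s}.ncard := by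
  classical
  have := Fintype.ofFinite T
  obtain ⟨m, hm⟩ := ne_zero_iff.1 hder
  let ℓ : MvPolynomial (Option T) K := ∑ i, C (coeff m (pderiv i f)) * X i
  have hℓ : ℓ ≠ 0 := by
    intro h
    have h2 := congrArg (eval (Pi.single i0 (1 : K))) h
    simp only [ℓ, map_sum, map_mul, eval_C, eval_X, map_zero] at h2
    rw [Finset.sum_eq_single i0] at h2
    · simp at h2; exact hm h2
    · intro b _ hb; simp [hb]
    · simp
  have htop : homogeneousComponent f.totalDegree f ≠ 0 := by
    intro h
    have hs : f.support.Nonempty := by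
      rw [Finset.nonempty_iff_ne_empty, Ne, support_eq_empty]; exact hirr.ne_zero
    obtain ⟨d, hd, hd2⟩ := Finset.exists_mem_eq_sup f.support hs (fun s => s.degree)
    have h3 : f.totalDegree = d.degree := hd2
    have h4 := congrArg (coeff d) h
    rw [coeff_homogeneousComponent, if_pos h3.symm, coeff_zero] at h4
    exact mem_support_iff.1 hd h4
  obtain ⟨β, hβ⟩ : ∃ β : Option T → K,
      eval β (homogeneousComponent f.totalDegree f * X none * ℓ) ≠ 0 := by
    by_contra! h
    exact (mul_ne_zero (mul_ne_zero htop (X_ne_zero none)) hℓ)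
      (MvPolynomial.funext (fun x => by rw [h x, map_zero]))
  rw [map_mul, map_mul, eval_X] at hβ
  have hβ1 := left_ne_zero_of_mul (left_ne_zero_of_mul hβ)
  have hβ0 := right_ne_zero_of_mul (left_ne_zero_of_mul hβ)
  have hβ2 := right_ne_zero_of_mul hβ
  let v : Option T → Polynomial (MvPolynomial T K) := fun o =>
    o.elim (Polynomial.C (C (β none)) * Polynomial.X)
      (fun s => Polynomial.C (X s) + Polynomial.C (C (β (some s))) * Polynomial.X)
  let Φ1 : MvPolynomial (Option T) K →ₐ[K] MvPolynomial (Option T) K :=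
    aeval (fun o : Option T => o.elim (C (β none) * X none)
      (fun s => X (some s) + C (β (some s)) * X none))
  let Φ2 : MvPolynomial (Option T) K →ₐ[K] MvPolynomial (Option T) K :=
    aeval (fun o : Option T => o.elim (C (β none)⁻¹ * X none)
      (fun s => X (some s) - C (β (some s) * (β none)⁻¹) * X none))
  have hC : ∀ a b : K, ∀ q : MvPolynomial (Option T) K, C a * (C b * q) = C (a * b) * q :=
    fun a b q => by rw [C_mul, mul_assoc]
  have h12 : Φ1.comp Φ2 = AlgHom.id K _ := by
    refine MvPolynomial.algHom_ext fun o => ?_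
    cases o with
    | none => simp [Φ1, Φ2, hC, hβ0, algebraMap_eq]
    | some s =>
      have e1 : (C (β none)⁻¹ * C (β none) : MvPolynomial (Option T) K) = 1 := by
        rw [← C_mul, inv_mul_cancel₀ hβ0, C_1]
      simp only [Φ1, Φ2, AlgHom.comp_apply, aeval_X, Option.elim_some, map_sub, map_mul, aeval_C,
        Option.elim_none, algebraMap_eq, AlgHom.id_apply]
      linear_combination (-C (β (some s)) * X none) * e1
  have h21 : Φ2.comp Φ1 = AlgHom.id K _ := by
    refine MvPolynomial.algHom_ext fun o => ?_
    cases o with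
    | none => simp [Φ1, Φ2, hC, hβ0, algebraMap_eq]
    | some s => simp [Φ1, Φ2, hC, algebraMap_eq]
  let E := (AlgEquiv.ofAlgHom Φ1 Φ2 h12 h21).trans (optionEquivLeft K T)
  have hE : (E : MvPolynomial (Option T) K →ₐ[K] Polynomial (MvPolynomial T K)) = aeval v := by
    refine MvPolynomial.algHom_ext fun o => ?_
    have hCC : ∀ c : K, optionEquivLeft K T (C c) = Polynomial.C (C c) := fun c => by
      rw [optionEquivLeft_C]
    cases o with
    | none => simp [E, Φ1, v, hCC, optionEquivLeft_X_none]
    | some s => simp [E, Φ1, v, hCC, optionEquivLeft_X_none, optionEquivLeft_X_some]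
  have hE' : ∀ q, E q = aeval v q := fun q => DFunLike.congr_fun hE q
  have hv : ∀ i, (v i).natDegree ≤ 1 := by
    rintro (_ | s)
    · exact ((Polynomial.natDegree_C_mul_le _ _).trans (Polynomial.natDegree_X_le))
    · exact Polynomial.natDegree_add_le_of_degree_le (by simp)
        ((Polynomial.natDegree_C_mul_le _ _).trans (Polynomial.natDegree_X_le))
  have hv1 : ∀ i, (v i).coeff 1 = algebraMap K (MvPolynomial T K) (β i) := by
    rintro (_ | s) <;> simp [v, algebraMap_eq, Polynomial.coeff_C]
  have hvd : ∀ i, Polynomial.derivative (v i) = algebraMap K _ (β i) := by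
    rintro (_ | s) <;> simp [v]
  obtain ⟨hd1, hd2⟩ := pp_coeff_top v β hv hv1 f _ le_rfl
  let lam := eval β (homogeneousComponent f.totalDegree f)
  let F : Polynomial (MvPolynomial T K) := Polynomial.C (C lam⁻¹) * aeval v f
  have hFc : F.coeff f.totalDegree = 1 := by
    simp only [F, Polynomial.coeff_C_mul, hd2, algebraMap_eq, ← C_mul]
    rw [inv_mul_cancel₀ hβ1, C_1]
  have hFd : F.natDegree ≤ f.totalDegree := (Polynomial.natDegree_C_mul_le _ _).trans hd1
  have hFm : F.Monic := Polynomial.monic_of_natDegree_le_of_coeff_eq_one _ hFd hFc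
  have hFn : F.natDegree = f.totalDegree :=
    le_antisymm hFd (Polynomial.le_natDegree_of_ne_zero (by rw [hFc]; exact one_ne_zero))
  have hunit : IsUnit (Polynomial.C (C lam⁻¹ : MvPolynomial T K)) :=
    ((isUnit_iff_ne_zero.2 (inv_ne_zero hβ1)).map C).map Polynomial.C
  have hFi : Irreducible F := by
    have h1 : Irreducible (aeval v f) := by
      rw [← hE']; exact (MulEquiv.irreducible_iff E).2 hirr
    obtain ⟨u, hu⟩ := hunit
    simp only [F, ← hu]
    exact (irreducible_units_mul u).2 h1
  have hFder : Polynomial.derivative F ≠ 0 := by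
    simp only [F]
    rw [Polynomial.derivative_C_mul, pp_derivative v β hvd f]
    refine mul_ne_zero hunit.ne_zero ?_
    rw [← hE', Ne, EmbeddingLike.map_eq_zero_iff]
    intro h
    have h2 := congrArg (coeff m) h
    apply hβ2
    simp only [ℓ, map_sum, map_mul, eval_C, eval_X]
    simp only [coeff_sum, coeff_C_mul, coeff_zero] at h2
    rw [← h2]
    exact Finset.sum_congr rfl fun i _ => mul_comm _ _
  let b : T → K := fun s => β (some s) * (β none)⁻¹
  let τ : T → A := fun s => t s - algebraMap K A (b s) * y
  let y' : A := algebraMap K A (β none)⁻¹ * y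
  have hcomp : (Polynomial.eval₂RingHom
      ((aeval τ : MvPolynomial T K →ₐ[K] A) : MvPolynomial T K →+* A) y').comp
      ((aeval v : MvPolynomial (Option T) K →ₐ[K] _) : MvPolynomial (Option T) K →+* _) =
      ((aeval (fun o : Option T => o.elim y t) : MvPolynomial (Option T) K →ₐ[K] A) :
        MvPolynomial (Option T) K →+* A) := by
    refine MvPolynomial.ringHom_ext (fun r => ?_) (fun o => ?_)
    · have : (aeval v (C r : MvPolynomial (Option T) K)) = Polynomial.C (C r) := by
        rw [aeval_C]; rfl
      simp only [RingHom.comp_apply, RingHom.coe_coe, this]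
      simp
    · cases o with
      | none =>
        simp [v, y', ← mul_assoc, ← map_mul, hβ0]
      | some s =>
        simp [v, y', ← mul_assoc, ← map_mul, τ, b]
  have hFy0 : F.eval₂ ((aeval τ : MvPolynomial T K →ₐ[K] A) : MvPolynomial T K →+* A) y' = 0 := by
    simp only [F]
    rw [Polynomial.eval₂_mul]
    have := RingHom.congr_fun hcomp f
    simp only [RingHom.comp_apply, RingHom.coe_coe, hf, Polynomial.coe_eval₂RingHom] at this
    rw [this, mul_zero]
  have hτ : IsTranscendenceBasis K τ := by
    have hyalg : IsAlgebraic (Algebra.adjoin K (Set.range τ)) y' := by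
      let j : MvPolynomial T K →ₐ[K] Algebra.adjoin K (Set.range τ) :=
        aeval (fun s => ⟨τ s, Algebra.subset_adjoin ⟨s, rfl⟩⟩)
      have hj : (algebraMap (Algebra.adjoin K (Set.range τ)) A).comp (j : MvPolynomial T K →+* _) =
          ((aeval τ : MvPolynomial T K →ₐ[K] A) : MvPolynomial T K →+* A) := by
        refine MvPolynomial.ringHom_ext (fun r => ?_) (fun s => ?_)
        · simp only [RingHom.comp_apply, RingHom.coe_coe, j, aeval_C]
          rfl
        · simp only [RingHom.comp_apply, RingHom.coe_coe, j, aeval_X]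
          rfl
      refine IsIntegral.isAlgebraic ⟨F.map (j : MvPolynomial T K →+* _), hFm.map _, ?_⟩
      rw [Polynomial.eval₂_map, hj, hFy0]
    have hyy : y = algebraMap K A (β none) * y' := by
      simp only [y', ← mul_assoc, ← map_mul]
      rw [mul_inv_cancel₀ hβ0, map_one, one_mul]
    have hKalg : ∀ c : K, IsAlgebraic (Algebra.adjoin K (Set.range τ)) (algebraMap K A c) :=
      fun c => isAlgebraic_algebraMap (algebraMap K (Algebra.adjoin K (Set.range τ)) c)
    have hyalg2 : IsAlgebraic (Algebra.adjoin K (Set.range τ)) y := by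
      rw [hyy]; exact (hKalg _).mul hyalg
    have halg : Algebra.IsAlgebraic (Algebra.adjoin K (Set.range τ)) A := by
      refine ⟨fun a => ?_⟩
      refine IsAlgebraic.adjoin_of_forall_isAlgebraic (s := Set.range t) ?_ (ht.isAlgebraic.1 a)
      rintro _ ⟨⟨s, rfl⟩, -⟩
      have : t s = τ s + algebraMap K A (b s) * y := by simp [τ]
      rw [this]
      refine IsAlgebraic.add ?_ ((hKalg _).mul hyalg2)
      exact isAlgebraic_algebraMap
        (⟨τ s, Algebra.subset_adjoin ⟨s, rfl⟩⟩ : Algebra.adjoin K (Set.range τ))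
    exact Algebra.IsAlgebraic.isTranscendenceBasis_of_lift_le_trdeg_of_finite K τ
      ht.lift_cardinalMk_eq_trdeg.le
  obtain ⟨a, ha1, ha2⟩ := pp_fiber τ hτ y' F hFm hFi hFder hFy0
  have hset : {φ : A →ₐ[K] K | ∀ s, φ (t s) - b s * φ y = a s} =
      {φ : A →ₐ[K] K | ∀ s, φ (τ s) = a s} := by
    ext φ
    simp [τ]
  refine ⟨b, a, ?_, ?_⟩
  · rw [hset]; exact ha1
  · rw [hset, ← hFn]; exact ha2

theorem pp_exists_pderiv {K σ : Type*} [Field K] [IsAlgClosed K] (f : MvPolynomial σ K)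
    (hirr : Irreducible f) : ∃ i, pderiv i f ≠ 0 := by
  classical
  by_contra! h
  obtain ⟨p, hp⟩ := CharP.exists K
  have hdvd : ∀ m ∈ f.support, ∀ i, p ∣ m i := by
    intro m hm i
    by_cases hmi : m i = 0
    · rw [hmi]; exact dvd_zero p
    have h1 : Finsupp.single i 1 ≤ m := by
      rw [Finsupp.single_le_iff]; omega
    have h2 := congrArg (coeff (m - Finsupp.single i 1)) (h i)
    rw [coeff_pderiv, tsub_add_cancel_of_le h1, coeff_zero] at h2
    have h3 := (mul_eq_zero.1 h2).resolve_left (mem_support_iff.1 hm)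
    rw [← CharP.cast_eq_zero_iff K p]
    have h4 : m i = (m - Finsupp.single i 1 : σ →₀ ℕ) i + 1 := by
      simp; omega
    rw [h4]; push_cast; exact h3
  rcases CharP.char_is_prime_or_zero K p with hpp | hp0
  · have : Fact p.Prime := ⟨hpp⟩
    have hroot : ∀ c : K, ∃ z, z ^ p = c := fun c => IsAlgClosed.exists_pow_nat_eq c hpp.pos
    choose rt hrt using hroot
    let q : (σ →₀ ℕ) → (σ →₀ ℕ) := fun m => m.mapRange (fun k => k / p) (by simp)
    let g : MvPolynomial σ K := ∑ m ∈ f.support, monomial (q m) (rt (coeff m f))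
    have hg : g ^ p = f := by
      rw [sum_pow_char p]
      conv_rhs => rw [f.as_sum]
      refine Finset.sum_congr rfl fun m hm => ?_
      rw [monomial_pow, hrt]
      have hqm : p • q m = m := by
        ext i
        simp only [q, Finsupp.smul_apply, Finsupp.mapRange_apply, smul_eq_mul]
        exact Nat.mul_div_cancel' (hdvd m hm i)
      rw [hqm]
    rw [← hg] at hirr
    exact not_irreducible_pow hpp.ne_one hirr
  · subst hp0
    have h0 : f = C (coeff 0 f) := by
      ext m
      rw [coeff_C]
      split_ifs with hm
      · rw [hm]
      · by_contra h3
        apply hm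
        ext i
        have := hdvd m (mem_support_iff.2 h3) i
        rw [zero_dvd_iff] at this
        simp [this]
    by_cases hc : coeff 0 f = 0
    · rw [hc, C_0] at h0; exact hirr.ne_zero h0
    · apply hirr.not_isUnit
      rw [h0]
      exact (isUnit_iff_ne_zero.2 hc).map C

theorem pp_irreducible_min {K A σ : Type*} [Field K] [CommRing A] [IsDomain A] [Algebra K A]
    (a : σ → A) (f : MvPolynomial σ K) (hf0 : f ≠ 0) (hfa : aeval a f = 0)
    (hmin : ∀ g : MvPolynomial σ K, g ≠ 0 → aeval a g = 0 → f.totalDegree ≤ g.totalDegree) :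
    Irreducible f := by
  refine ⟨fun h' ↦ (h'.map (aeval a)).ne_zero hfa, fun q₁ q₂ e ↦ ?_⟩
  wlog h₁ : aeval a q₁ = 0 generalizing q₁ q₂
  · exact .symm (this q₂ q₁ (e.trans (mul_comm ..)) <| by
      have h2 : aeval a q₁ * aeval a q₂ = 0 := by rw [← map_mul, ← e, hfa]
      exact (mul_eq_zero.1 h2).resolve_left h₁)
  have ne := mul_ne_zero_iff.mp (e ▸ hf0)
  have := hmin q₁ ne.1 h₁
  rw [e, totalDegree_mul_of_isDomain ne.1 ne.2, add_le_iff_nonpos_right, nonpos_iff_eq_zero] at this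
  refine .inr (isUnit_iff_totalDegree_of_isReduced.mpr ⟨?_, this⟩)
  rw [totalDegree_eq_zero_iff_eq_C.mp this] at ne
  simpa using ne.2

theorem pp_irreducible_rename {K σ τ : Type*} [Field K] (g : σ → τ) (hg : Function.Injective g)
    (f : MvPolynomial σ K) (hf : Irreducible f) : Irreducible (rename g f) := by
  have h1 : rename g f = rename (Subtype.val : Set.range g → τ)
      (renameEquiv K (Equiv.ofInjective g hg) f) := by
    rw [renameEquiv_apply, rename_rename]
    rfl
  rw [h1, UniqueFactorizationMonoid.irreducible_iff_prime, prime_rename_iff,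
    ← UniqueFactorizationMonoid.irreducible_iff_prime, MulEquiv.irreducible_iff]
  exact hf

theorem pp_lemma3 {K A ι : Type*} [Field K] [IsAlgClosed K] [Finite ι] [CommRing A] [IsDomain A]
    [Algebra K A] [Algebra.FiniteType K A] (x : ι → A) (hx : Algebra.adjoin K (Set.range x) = ⊤)
    (J : Set ι) (hJ : ¬ AlgebraicIndepOn K x J) :
    ∃ (f : MvPolynomial ι K) (T : Set ι) (j0 : ι) (b a : T → K), f ≠ 0 ∧ ↑f.vars ⊆ J ∧
      aeval x f = 0 ∧ j0 ∉ T ∧ IsTranscendenceBasis K (fun s : T => x s) ∧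
      {φ : A →ₐ[K] K | ∀ s : T, φ (x s) - b s * φ (x j0) = a s}.Finite ∧
      f.totalDegree ≤ {φ : A →ₐ[K] K | ∀ s : T, φ (x s) - b s * φ (x j0) = a s}.ncard := by
  classical
  obtain ⟨J', hJ', hJmin⟩ := (Set.toFinite {S : Set ι | S ⊆ J ∧ ¬ AlgebraicIndepOn K x S}).exists_minimal
    ⟨J, subset_rfl, hJ⟩
  obtain ⟨hJ'J, hJ'd⟩ := hJ'
  have hne : J'.Nonempty := by
    rw [Set.nonempty_iff_ne_empty]
    rintro rfl
    exact hJ'd algebraicIndependent_empty_type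
  obtain ⟨j0, hj0⟩ := hne
  have hS : AlgebraicIndepOn K x (J' \ {j0}) := by
    by_contra h
    have := hJmin (y := J' \ {j0}) ⟨Set.sdiff_subset.trans hJ'J, h⟩ Set.sdiff_subset hj0
    exact this.2 rfl
  obtain ⟨T, hST, hT, hTmax⟩ := (Set.toFinite {S : Set ι | AlgebraicIndepOn K x S}).exists_le_maximal hS
  have hTind : AlgebraicIndepOn K x T := hT
  have hj0T : j0 ∉ T := by
    intro h
    apply hJ'd
    refine hTind.mono fun j hj => ?_
    by_cases hjj : j = j0
    · rw [hjj]; exact h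
    · exact hST ⟨hj, hjj⟩
  have htb : IsTranscendenceBasis K (fun s : T => x s) := by
    rw [hTind.isTranscendenceBasis_iff_isAlgebraic]
    have hr : Set.range (fun s : T => x s) = x '' T := by
      rw [Set.image_eq_range]
    rw [hr]
    refine ⟨fun z => ?_⟩
    refine IsAlgebraic.adjoin_of_forall_isAlgebraic (s := Set.range x) ?_ ?_
    · rintro _ ⟨⟨i, rfl⟩, hi⟩
      by_contra htr
      have h2 := hTmax (y := insert i T) (hTind.insert htr) (Set.subset_insert _ _)
        (Set.mem_insert _ _)
      exact hi ⟨i, h2, rfl⟩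
    · exact isAlgebraic_algebraMap (⟨z, by rw [hx]; trivial⟩ : Algebra.adjoin K (Set.range x))
  have hex : ∃ d : ℕ, ∃ p : MvPolynomial J' K, p ≠ 0 ∧ aeval (fun j : J' => x j) p = 0 ∧
      p.totalDegree = d := by
    rw [AlgebraicIndepOn, algebraicIndependent_iff] at hJ'd
    push Not at hJ'd
    obtain ⟨p, hp, hp0⟩ := hJ'd
    exact ⟨_, p, hp0, hp, rfl⟩
  obtain ⟨f0, hf0, hf0a, hf0d⟩ := Nat.find_spec hex
  have hirr : Irreducible f0 := pp_irreducible_min _ f0 hf0 hf0a (fun g hg hga => by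
    rw [hf0d]; exact Nat.find_min' hex ⟨g, hg, hga, rfl⟩)
  let g : J' → Option T := fun j => if h : (j : ι) = j0 then none else some ⟨j, hST ⟨j.2, h⟩⟩
  let h : Option T → ι := fun o => o.elim j0 Subtype.val
  have hhg : ∀ j, h (g j) = j := by
    intro j
    by_cases hj : (j : ι) = j0 <;> simp [h, g, hj]
  have hginj : Function.Injective g := by
    intro j j' hjj
    apply Subtype.ext
    rw [← hhg j, ← hhg j', hjj]
  have hirr1 := pp_irreducible_rename g hginj f0 hirr
  obtain ⟨i0, hi0⟩ := pp_exists_pderiv _ hirr1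
  have hxh : (fun o : Option T => o.elim (x j0) (fun s : T => x s)) = fun o => x (h o) := by
    funext o
    cases o <;> rfl
  obtain ⟨b, a, hfin, hcard⟩ := pp_lemma2 (fun s : T => x s) htb (x j0) (rename g f0) hirr1 i0 hi0
    (by
      rw [hxh, aeval_rename]
      have : (fun o => x (h o)) ∘ g = fun j : J' => x j := by
        funext j; simp [hhg]
      rw [this, hf0a])
  have hcomp : h ∘ g = Subtype.val := funext hhg
  refine ⟨rename h (rename g f0), T, j0, b, a, ?_, ?_, ?_, hj0T, htb, hfin,
    (totalDegree_rename_le _ _).trans hcard⟩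
  · rw [rename_rename, hcomp]
    intro h0
    exact hf0 (rename_injective _ Subtype.val_injective (by rw [h0, map_zero]))
  · rw [rename_rename, hcomp]
    intro i hi
    have := vars_rename _ _ hi
    rw [Finset.mem_image] at this
    obtain ⟨j, -, rfl⟩ := this
    exact hJ'J j.2
  · rw [rename_rename, hcomp, aeval_rename]
    exact hf0a

theorem pp_krull_integral (R S : Type*) [CommRing R] [CommRing S] [IsDomain S] [Algebra R S]
    [Algebra.IsIntegral R S] (hinj : Function.Injective (algebraMap R S)) :
    ringKrullDim S = ringKrullDim R := by
  apply le_antisymm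
  · refine Order.krullDim_le_of_strictMono (PrimeSpectrum.comap (algebraMap R S)) ?_
    intro P Q h
    have hPp := P.2
    exact Ideal.IsIntegral.comap_lt_comap (R := R) (I := P.asIdeal) (J := Q.asIdeal) h
  · refine iSup_le fun l => ?_
    obtain ⟨P, hP, hPc⟩ := Ideal.exists_ideal_over_prime_of_isIntegral_of_isDomain (S := S)
      (RelSeries.head l).asIdeal (by
        rw [(RingHom.injective_iff_ker_eq_bot _).1 hinj]; exact bot_le)
    have : P.LiesOver (RelSeries.head l).asIdeal := ⟨hPc.symm⟩
    obtain ⟨L, hL, -⟩ := Ideal.exists_ltSeries_of_hasGoingUp l P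
    rw [← hL]
    exact Order.LTSeries.length_le_krullDim L

theorem pp_krull_trdeg {K A T : Type*} [Field K] [Finite T] [CommRing A] [IsDomain A]
    [Algebra K A] [Algebra.FiniteType K A] (t : T → A) (ht : IsTranscendenceBasis K t) :
    ringKrullDim A = (Nat.card T : WithBot ℕ∞) := by
  obtain ⟨s, g, hg, hgi⟩ := exists_integral_inj_algHom_of_fg K A
  let := (g : MvPolynomial (Fin s) K →+* A).toAlgebra
  have : Algebra.IsIntegral (MvPolynomial (Fin s) K) A := ⟨hgi⟩
  rw [pp_krull_integral (MvPolynomial (Fin s) K) A hg, ringKrullDim_of_isNoetherianRing,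
    ringKrullDim_eq_zero_of_field, zero_add]
  have hag : aeval (fun i => g (X i)) = g := by
    ext i; simp
  have hind : AlgebraicIndependent K (fun i => g (X i)) := by
    rw [AlgebraicIndependent, hag]; exact hg
  have hb : IsTranscendenceBasis K (fun i => g (X i)) := by
    rw [hind.isTranscendenceBasis_iff_isAlgebraic]
    refine ⟨fun z => ?_⟩
    obtain ⟨p, hp, hpz⟩ := hgi z
    let j : MvPolynomial (Fin s) K →ₐ[K] Algebra.adjoin K (Set.range (fun i => g (X i))) :=
      aeval (fun i => ⟨g (X i), Algebra.subset_adjoin ⟨i, rfl⟩⟩)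
    have hj : (algebraMap (Algebra.adjoin K (Set.range (fun i => g (X i)))) A).comp
        (j : MvPolynomial (Fin s) K →+* _) = (g : MvPolynomial (Fin s) K →+* A) := by
      refine MvPolynomial.ringHom_ext (fun r => ?_) (fun s => ?_)
      · simp only [RingHom.comp_apply, RingHom.coe_coe, j, aeval_C]
        rw [← algebraMap_eq, AlgHom.commutes]
        rfl
      · simp only [RingHom.comp_apply, RingHom.coe_coe, j, aeval_X]
        rfl
    refine IsIntegral.isAlgebraic ⟨p.map (j : MvPolynomial (Fin s) K →+* _), hp.map _, ?_⟩
    rw [Polynomial.eval₂_map, hj]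
    exact hpz
  have h1 := hb.lift_cardinalMk_eq_trdeg
  have h2 := ht.lift_cardinalMk_eq_trdeg
  have h3 : Nat.card (Fin s) = Nat.card T := by
    have e1 := congrArg Cardinal.toNat h1
    have e2 := congrArg Cardinal.toNat h2
    simp only [Cardinal.toNat_lift] at e1 e2
    unfold Nat.card
    rw [e1, e2]
  rw [h3]

section geom

variable {K : Type*} [Field K] {n : ℕ}

theorem pp_mem_I {V : Set (Fin n → K)} {f : MvPolynomial (Fin n) K} :
    f ∈ _root_.vanishingIdeal K n V ↔ ∀ x ∈ V, eval x f = 0 := Iff.rfl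

theorem pp_I_anti {V W : Set (Fin n → K)} (h : V ⊆ W) :
    _root_.vanishingIdeal K n W ≤ _root_.vanishingIdeal K n V := fun _ hf x hx => hf x (h hx)

theorem pp_closed_zeroLocus (S : Set (MvPolynomial (Fin n) K)) :
    IsClosed (_root_.zeroLocus K n S) := by
  rw [← isOpen_compl_iff]
  exact TopologicalSpace.isOpen_generateFrom_of_mem ⟨S, rfl⟩

theorem pp_closed_mem {C : Set (Fin n → K)} (hC : IsClosed C) (x : Fin n → K)
    (hx : ∀ f ∈ _root_.vanishingIdeal K n C, eval x f = 0) : x ∈ C := by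
  have key : ∀ U : Set (Fin n → K), TopologicalSpace.GenerateOpen
      {U | ∃ S : Set (MvPolynomial (Fin n) K), U = (_root_.zeroLocus K n S)ᶜ} U →
      ∀ x, x ∈ U → ∃ f ∈ _root_.vanishingIdeal K n Uᶜ, eval x f ≠ 0 := by
    intro U hU
    induction hU with
    | basic U h =>
      obtain ⟨S, rfl⟩ := h
      intro x hx
      by_contra! h
      apply hx
      intro f hf
      refine h f fun y hy => ?_
      rw [compl_compl] at hy
      exact hy f hf
    | univ =>
      intro x _
      exact ⟨1, fun y hy => by simp at hy, by simp⟩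
    | inter U V _ _ h1 h2 =>
      rintro x ⟨hxU, hxV⟩
      obtain ⟨f, hf, hfx⟩ := h1 x hxU
      obtain ⟨g, hg, hgx⟩ := h2 x hxV
      refine ⟨f * g, fun y hy => ?_, by rw [map_mul]; exact mul_ne_zero hfx hgx⟩
      rw [Set.compl_inter] at hy
      rw [map_mul]
      rcases hy with hy | hy
      · rw [hf y hy, zero_mul]
      · rw [hg y hy, mul_zero]
    | sUnion S _ h =>
      rintro x ⟨U, hUS, hxU⟩
      obtain ⟨f, hf, hfx⟩ := h U hUS x hxU
      exact ⟨f, pp_I_anti (Set.compl_subset_compl.2 (Set.subset_sUnion_of_mem hUS)) hf, hfx⟩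
  by_contra hxC
  obtain ⟨f, hf, hfx⟩ := key Cᶜ hC.isOpen_compl x hxC
  rw [compl_compl] at hf
  exact hfx (hx f hf)

theorem pp_subset_of_I_le {C D : Set (Fin n → K)} (hD : IsClosed D)
    (h : _root_.vanishingIdeal K n D ≤ _root_.vanishingIdeal K n C) : C ⊆ D :=
  fun x hx => pp_closed_mem hD x (fun f hf => h hf x hx)

theorem pp_I_prime {V : Set (Fin n → K)} (hV : IsIrreducible V) :
    (_root_.vanishingIdeal K n V).IsPrime := by
  constructor
  · intro h
    obtain ⟨x, hx⟩ := hV.1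
    have : (1 : MvPolynomial (Fin n) K) ∈ _root_.vanishingIdeal K n V := by rw [h]; trivial
    have := this x hx
    simp at this
  · intro f g hfg
    have h1 := isPreirreducible_iff_isClosed_union_isClosed.1 hV.2 _ _
      (pp_closed_zeroLocus {f}) (pp_closed_zeroLocus {g}) (fun x hx => by
        have := hfg x hx
        rw [map_mul, mul_eq_zero] at this
        rcases this with h | h
        · left; rintro _ rfl; exact h
        · right; rintro _ rfl; exact h)
    rcases h1 with h | h
    · left; exact fun x hx => h hx f rfl
    · right; exact fun x hx => h hx g rfl

theorem pp_noetherian : TopologicalSpace.NoetherianSpace (Fin n → K) := by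
  refine ((TopologicalSpace.noetherianSpace_TFAE (Fin n → K)).out 0 1 :
    TopologicalSpace.NoetherianSpace (Fin n → K) ↔
      WellFoundedLT (TopologicalSpace.Closeds (Fin n → K))).2 ?_
  let F : TopologicalSpace.Closeds (Fin n → K) → Ideal (MvPolynomial (Fin n) K) :=
    fun C => _root_.vanishingIdeal K n C
  have hF : StrictAnti F := by
    intro C D h
    refine lt_of_le_not_ge (pp_I_anti h.le) fun h2 => ?_
    exact h.not_ge (pp_subset_of_I_le C.isClosed h2)
  exact hF.wellFoundedLT

variable [IsAlgClosed K]

theorem pp_I_Z (P : Ideal (MvPolynomial (Fin n) K)) [P.IsPrime] :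
    _root_.vanishingIdeal K n (_root_.zeroLocus K n P) = P := by
  have h := MvPolynomial.IsPrime.vanishingIdeal_zeroLocus (K := K) P
  conv_rhs => rw [← h]
  ext f
  rw [MvPolynomial.mem_vanishingIdeal_iff]
  simp only [pp_mem_I, MvPolynomial.mem_zeroLocus_iff, aeval_eq_eval]
  rfl

theorem pp_vdim (V : Set (Fin n → K)) (hV : IsClosed V) :
    vdim K n V = ringKrullDim (MvPolynomial (Fin n) K ⧸ _root_.vanishingIdeal K n V) := by
  rw [ringKrullDim_quotient, ← Order.krullDim_orderDual, vdim, topologicalKrullDim]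
  have himg : ∀ W : TopologicalSpace.IrreducibleCloseds V,
      IsClosed (Subtype.val '' (W : Set V)) := fun W =>
    hV.isClosedEmbedding_subtypeVal.isClosedMap _ W.isClosed
  let F : TopologicalSpace.IrreducibleCloseds V →
      (PrimeSpectrum.zeroLocus (R := MvPolynomial (Fin n) K) (_root_.vanishingIdeal K n V))ᵒᵈ :=
    fun W => OrderDual.toDual ⟨⟨_root_.vanishingIdeal K n (Subtype.val '' (W : Set V)),
      pp_I_prime (W.isIrreducible.image _ continuous_subtype_val.continuousOn)⟩,
      pp_I_anti (Subtype.coe_image_subset _ _)⟩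
  have hF : ∀ W W', F W ≤ F W' ↔ W ≤ W' := by
    intro W W'
    change _root_.vanishingIdeal K n (Subtype.val '' (W' : Set V)) ≤
      _root_.vanishingIdeal K n (Subtype.val '' (W : Set V)) ↔ (W : Set V) ⊆ W'
    constructor
    · intro h
      exact (Set.image_subset_image_iff Subtype.val_injective).1 (pp_subset_of_I_le (himg W') h)
    · intro h
      exact pp_I_anti (Set.image_mono h)
  have hsurj : Function.Surjective F := by
    rintro ⟨⟨P, hP⟩, hPV⟩
    have hPV' : _root_.vanishingIdeal K n V ≤ P := hPV
    have hZV : _root_.zeroLocus K n P ⊆ V := pp_subset_of_I_le hV (by rw [pp_I_Z]; exact hPV')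
    have hval : Subtype.val '' (Subtype.val ⁻¹' (_root_.zeroLocus K n P) : Set V) =
        _root_.zeroLocus K n P := by
      rw [Subtype.image_preimage_coe]
      exact Set.inter_eq_right.2 hZV
    have hirr : IsIrreducible (Subtype.val ⁻¹' (_root_.zeroLocus K n P) : Set V) := by
      constructor
      · rw [← Set.image_nonempty, hval]
        by_contra h
        rw [Set.not_nonempty_iff_eq_empty] at h
        have h2 := pp_I_Z P
        rw [h] at h2
        apply hP.ne_top
        rw [← h2, Ideal.eq_top_iff_one]
        exact fun x hx => absurd hx (Set.notMem_empty x)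
      · rw [isPreirreducible_iff_isClosed_union_isClosed]
        intro z1 z2 hz1 hz2 hz
        have c1 : IsClosed (Subtype.val '' z1) := hV.isClosedEmbedding_subtypeVal.isClosedMap _ hz1
        have c2 : IsClosed (Subtype.val '' z2) := hV.isClosedEmbedding_subtypeVal.isClosedMap _ hz2
        have hsub : _root_.zeroLocus K n P ⊆ Subtype.val '' z1 ∪ Subtype.val '' z2 := by
          rw [← hval, ← Set.image_union]; exact Set.image_mono hz
        have hmul : _root_.vanishingIdeal K n (Subtype.val '' z1) *
            _root_.vanishingIdeal K n (Subtype.val '' z2) ≤ P := by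
          rw [Ideal.mul_le]
          intro f hf g hg
          rw [← pp_I_Z P]
          intro x hx
          rw [map_mul]
          rcases hsub hx with h | h
          · rw [hf x h, zero_mul]
          · rw [hg x h, mul_zero]
        rcases hP.mul_le.1 hmul with h | h
        · left
          rw [← Set.image_subset_image_iff Subtype.val_injective, hval]
          exact pp_subset_of_I_le c1 (by rw [pp_I_Z]; exact h)
        · right
          rw [← Set.image_subset_image_iff Subtype.val_injective, hval]
          exact pp_subset_of_I_le c2 (by rw [pp_I_Z]; exact h)
    refine ⟨⟨_, hirr, (pp_closed_zeroLocus _).preimage continuous_subtype_val⟩, ?_⟩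
    apply congrArg OrderDual.toDual
    apply Subtype.ext
    apply PrimeSpectrum.ext
    change _root_.vanishingIdeal K n (Subtype.val '' _) = P
    rw [TopologicalSpace.IrreducibleCloseds.coe_mk, hval, pp_I_Z]
  exact Order.krullDim_eq_of_orderIso
    (RelIso.ofSurjective (OrderEmbedding.ofMapLEIff F hF) hsurj)

theorem pp_linear (T : Set (Fin n)) (j0 : Fin n) (hj0 : j0 ∉ T) (b a : T → K) :
    IsAffineSubspace K n {x | ∀ s : T, x s - b s * x j0 = a s} ∧
    vdim K n {x | ∀ s : T, x s - b s * x j0 = a s} = (Nat.card ↥(Tᶜ) : WithBot ℕ∞) := by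
  classical
  set L : Set (Fin n → K) := {x | ∀ s : T, x s - b s * x j0 = a s} with hL
  let S : Set (MvPolynomial (Fin n) K) := Set.range (fun s : T => X (s : Fin n) - C (b s) * X j0 - C (a s))
  have hLS : L = _root_.zeroLocus K n S := by
    ext x
    constructor
    · rintro h _ ⟨s, rfl⟩
      simp [h s]
    · intro h s
      have := h _ ⟨s, rfl⟩
      simp only [map_sub, map_mul, eval_X, eval_C] at this
      exact sub_eq_zero.1 this
  refine ⟨⟨S, ?_, hLS⟩, ?_⟩
  · rintro _ ⟨s, rfl⟩
    refine (totalDegree_sub _ _).trans (max_le ((totalDegree_sub _ _).trans (max_le ?_ ?_)) ?_)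
    · simp
    · refine (totalDegree_mul _ _).trans ?_
      simp
    · simp
  rw [pp_vdim L (by rw [hLS]; exact pp_closed_zeroLocus S)]
  let w : Fin n → MvPolynomial ↥(Tᶜ) K := fun i =>
    if h : i ∈ T then C (a ⟨i, h⟩) + C (b ⟨i, h⟩) * X ⟨j0, hj0⟩ else X ⟨i, h⟩
  let ψ : MvPolynomial (Fin n) K →ₐ[K] MvPolynomial ↥(Tᶜ) K := aeval w
  have hψs : Function.Surjective ψ := by
    intro q
    refine ⟨rename Subtype.val q, ?_⟩
    simp only [ψ, aeval_rename]
    have : w ∘ (Subtype.val : ↥(Tᶜ) → Fin n) = X := by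
      funext i
      have hi : (i : Fin n) ∉ T := i.2
      simp [w, hi]
    rw [this, aeval_X_left_apply]
  have hev : ∀ (u : ↥(Tᶜ) → K) (f : MvPolynomial (Fin n) K),
      eval u (ψ f) = eval (fun i => eval u (w i)) f := by
    intro u f
    have : (eval u).comp (ψ : MvPolynomial (Fin n) K →+* _) = eval (fun i => eval u (w i)) := by
      refine MvPolynomial.ringHom_ext (fun r => ?_) (fun i => ?_)
      · simp [ψ, algebraMap_eq]
      · simp [ψ]
    exact RingHom.congr_fun this f
  have hker : RingHom.ker (ψ : MvPolynomial (Fin n) K →+* MvPolynomial ↥(Tᶜ) K) =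
      _root_.vanishingIdeal K n L := by
    ext f
    rw [RingHom.mem_ker, pp_mem_I]
    constructor
    · intro h x hx
      have h2 := hev (fun i => x i) f
      rw [show ψ f = 0 from h, map_zero] at h2
      have h3 : (fun i => eval (fun i : ↥(Tᶜ) => x i) (w i)) = x := by
        funext i
        by_cases hi : i ∈ T
        · have := hx ⟨i, hi⟩
          simp only [w, hi, dif_pos, map_add, map_mul, eval_C, eval_X]
          rw [← this]; ring
        · simp [w, hi]
      rw [h3] at h2
      exact h2.symm
    · intro h
      change ψ f = 0
      refine MvPolynomial.funext fun u => ?_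
      rw [hev, map_zero]
      apply h
      intro s
      have hs : (s : Fin n) ∈ T := s.2
      simp [w, hj0]
  let e := RingHom.quotientKerEquivOfSurjective
    (f := (ψ : MvPolynomial (Fin n) K →+* MvPolynomial ↥(Tᶜ) K)) hψs
  rw [← hker, ringKrullDim_eq_of_ringEquiv e, ringKrullDim_of_isNoetherianRing,
    ringKrullDim_eq_zero_of_field, zero_add]

end geom

theorem pp_extend {K A ι : Type*} [Field K] [Finite ι] [CommRing A] [IsDomain A]
    [Algebra K A] (x : ι → A) (hx : Algebra.adjoin K (Set.range x) = ⊤)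
    (J : Set ι) (hS : AlgebraicIndepOn K x J) :
    ∃ T : Set ι, J ⊆ T ∧ IsTranscendenceBasis K (fun s : T => x s) := by
  obtain ⟨T, hST, hT, hTmax⟩ :=
    (Set.toFinite {S : Set ι | AlgebraicIndepOn K x S}).exists_le_maximal hS
  have hTind : AlgebraicIndepOn K x T := hT
  refine ⟨T, hST, ?_⟩
  rw [hTind.isTranscendenceBasis_iff_isAlgebraic]
  have hr : Set.range (fun s : T => x s) = x '' T := by
    rw [Set.image_eq_range]
  rw [hr]
  refine ⟨fun z => ?_⟩
  refine IsAlgebraic.adjoin_of_forall_isAlgebraic (s := Set.range x) ?_ ?_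
  · rintro _ ⟨⟨i, rfl⟩, hi⟩
    by_contra htr
    have h2 := hTmax (y := insert i T) (hTind.insert htr) (Set.subset_insert _ _)
      (Set.mem_insert _ _)
    exact hi ⟨i, h2, rfl⟩
  · exact isAlgebraic_algebraMap (⟨z, by rw [hx]; trivial⟩ : Algebra.adjoin K (Set.range x))

theorem pp_component {K : Type*} [Field K] [IsAlgClosed K] {n k : ℕ}
    (W : Set (Fin n → K)) (hWc : IsClosed W) (hWi : IsIrreducible W)
    (hdim : vdim K n W ≤ (k : WithBot ℕ∞))
    (J : Finset (Fin n)) (hJ : J.card = k + 1) :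
    ∃ f : MvPolynomial (Fin n) K, f ≠ 0 ∧ f.vars ⊆ J ∧ (f.totalDegree : ℕ∞) ≤ irrDegree K n W ∧
      ∀ x ∈ W, eval x f = 0 := by
  have hP := pp_I_prime hWi
  set I := _root_.vanishingIdeal K n W with hI
  let x : Fin n → (MvPolynomial (Fin n) K ⧸ I) := fun i => Ideal.Quotient.mkₐ K I (X i)
  have hae : ∀ f, aeval x f = Ideal.Quotient.mkₐ K I f := by
    intro f
    have : aeval x = Ideal.Quotient.mkₐ K I := MvPolynomial.algHom_ext (fun i => by simp [x])
    rw [this]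
  have hx : Algebra.adjoin K (Set.range x) = ⊤ := by
    rw [Algebra.adjoin_range_eq_range_aeval, AlgHom.range_eq_top]
    intro z
    obtain ⟨f, rfl⟩ := Ideal.Quotient.mkₐ_surjective K I z
    exact ⟨f, hae f⟩
  have hvd := pp_vdim W hWc
  have hJd : ¬ AlgebraicIndepOn K x (J : Set (Fin n)) := by
    intro h
    obtain ⟨T, hJT, hT⟩ := pp_extend x hx _ h
    rw [hvd, pp_krull_trdeg _ hT] at hdim
    have h1 : Nat.card T ≤ k := by exact_mod_cast hdim
    have h2 := Set.ncard_le_ncard hJT (Set.toFinite T)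
    rw [Set.ncard_coe_finset, hJ, ← Nat.card_coe_set_eq] at h2
    omega
  obtain ⟨f, T, j0, b, a, hf0, hfv, hfx, hj0, htb, hfin, hdeg⟩ := pp_lemma3 x hx _ hJd
  have hmem : ∀ g ∈ I, aeval x g = 0 := by
    intro g hg
    rw [hae]
    exact Ideal.Quotient.eq_zero_iff_mem.2 hg
  refine ⟨f, hf0, by exact_mod_cast hfv, ?_, ?_⟩
  · obtain ⟨hL1, hL2⟩ := pp_linear T j0 hj0 b a
    set L : Set (Fin n → K) := {x | ∀ s : T, x s - b s * x j0 = a s} with hL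
    set H := {φ : (MvPolynomial (Fin n) K ⧸ I) →ₐ[K] K |
      ∀ s : T, φ (x s) - b s * φ (x j0) = a s} with hH
    let p : ((MvPolynomial (Fin n) K ⧸ I) →ₐ[K] K) → (Fin n → K) := fun φ i => φ (x i)
    have hpe : ∀ φ g, eval (p φ) g = φ (aeval x g) := by
      intro φ g
      have : (aeval (p φ) : MvPolynomial (Fin n) K →ₐ[K] K) = φ.comp (aeval x) :=
        MvPolynomial.algHom_ext (fun i => by simp [p])
      rw [← MvPolynomial.aeval_eq_eval]
      exact DFunLike.congr_fun this g
    have hpinj : Function.Injective p := by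
      intro φ ψ h
      apply AlgHom.ext
      intro z
      obtain ⟨g, rfl⟩ := Ideal.Quotient.mkₐ_surjective K I z
      rw [← hae, ← hpe, ← hpe, h]
    have himg : p '' H = W ∩ L := by
      ext y
      constructor
      · rintro ⟨φ, hφ, rfl⟩
        refine ⟨pp_closed_mem hWc _ fun g hg => ?_, hφ⟩
        rw [hpe, hmem g hg, map_zero]
      · rintro ⟨hyW, hyL⟩
        let φ : (MvPolynomial (Fin n) K ⧸ I) →ₐ[K] K := Ideal.Quotient.liftₐ I (aeval y)
          (fun g hg => by rw [MvPolynomial.aeval_eq_eval]; exact hg y hyW)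
        have hφ : p φ = y := by
          funext i
          change aeval y (X i) = y i
          simp
        have hφi : ∀ i, φ (x i) = y i := fun i => congrFun hφ i
        refine ⟨φ, fun s => ?_, hφ⟩
        rw [hφi, hφi]; exact hyL s
    have hWLfin : (W ∩ L).Finite := by rw [← himg]; exact hfin.image p
    have hcard : H.ncard = (W ∩ L).ncard := by
      rw [← himg, Set.ncard_image_of_injective _ hpinj]
    have hsum : vdim K n W + vdim K n L = (n : WithBot ℕ∞) := by
      rw [hL2, hvd, pp_krull_trdeg _ htb, Nat.card_coe_set_eq, Nat.card_coe_set_eq]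
      have := Set.ncard_add_ncard_compl T
      rw [Nat.card_fin] at this
      exact_mod_cast this
    rw [hcard] at hdeg
    refine le_trans (by exact_mod_cast hdeg : (f.totalDegree : ℕ∞) ≤ ((W ∩ L).ncard : ℕ∞)) ?_
    exact le_iSup_of_le L (le_iSup_of_le hL1 (le_iSup_of_le hsum (le_iSup_of_le hWLfin le_rfl)))
  · intro y hy
    have : f ∈ I := by
      rw [hae] at hfx
      exact Ideal.Quotient.eq_zero_iff_mem.1 hfx
    exact this y hy

theorem projection_polynomial
    {K : Type*} [Field K] [IsAlgClosed K] {n k d : ℕ}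
    (V : Set (Fin n → K)) (hV : IsAffineVariety K n V)
    (hkn : k < n) (hVdim : vdim K n V = (k : WithBot ℕ∞)) (hVdeg : vdeg K n V = (d : ℕ∞))
    (J : Finset (Fin n)) (hJ : J.card = k + 1) :
    ∃ f : MvPolynomial (Fin n) K, f ≠ 0 ∧ f.vars ⊆ J ∧ f.totalDegree ≤ d ∧
      ∀ x ∈ V, eval x f = 0 := by
  classical
  have hVc : IsClosed V := by
    obtain ⟨s, rfl⟩ := hV
    exact pp_closed_zeroLocus _
  have hn0 : TopologicalSpace.NoetherianSpace (Fin n → K) := pp_noetherian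
  have hn : TopologicalSpace.NoetherianSpace ↥V :=
    Topology.IsInducing.subtypeVal.noetherianSpace
  have hfin : (irreducibleComponents ↥V).Finite :=
    TopologicalSpace.NoetherianSpace.finite_irreducibleComponents
  have : Fintype (irreducibleComponents ↥V) := hfin.fintype
  have hcomp : ∀ W : irreducibleComponents ↥V, ∃ f : MvPolynomial (Fin n) K, f ≠ 0 ∧ f.vars ⊆ J ∧
      (f.totalDegree : ℕ∞) ≤ irrDegree K n (Subtype.val '' (W.1 : Set ↥V)) ∧
      ∀ x ∈ Subtype.val '' (W.1 : Set ↥V), eval x f = 0 := by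
    intro W
    refine pp_component _ ?_ ?_ ?_ J hJ
    · exact hVc.isClosedEmbedding_subtypeVal.isClosedMap _
        (isClosed_of_mem_irreducibleComponents _ W.2)
    · exact IsIrreducible.image W.2.1 _ continuous_subtype_val.continuousOn
    · rw [← hVdim]
      exact Topology.IsInducing.topologicalKrullDim_le
        (Topology.IsEmbedding.inclusion (Subtype.coe_image_subset V W.1)).isInducing
  choose f hf0 hfv hfd hfz using hcomp
  refine ⟨∏ W, f W, Finset.prod_ne_zero_iff.2 fun W _ => hf0 W, ?_, ?_, ?_⟩
  · refine (vars_prod _).trans ?_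
    exact Finset.biUnion_subset.2 fun W _ => hfv W
  · have h1 : ((∏ W, f W).totalDegree : ℕ∞) ≤ d := by
      rw [← hVdeg, vdeg, tsum_fintype]
      refine le_trans ?_ (Finset.sum_le_sum fun W _ => hfd W)
      have := totalDegree_finsetProd Finset.univ f
      exact_mod_cast this
    exact_mod_cast h1
  · intro x hx
    rw [map_prod]
    exact Finset.prod_eq_zero (Finset.mem_univ
      ⟨irreducibleComponent (⟨x, hx⟩ : ↥V), irreducibleComponent_mem_irreducibleComponents _⟩)
      (hfz _ x ⟨⟨x, hx⟩, mem_irreducibleComponent, rfl⟩)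
end

section
/- Let 𝔽 be a field with algebraic closure 𝔽̄ and let V ⊆ 𝔽̄^n be an affine variety of dimension k < n and degree d that is defined over 𝔽, i.e., the vanishing ideal I(V) ⊆ 𝔽̄[x_1,…,x_n] is generated by finitely many polynomials g_1,…,g_t with coefficients in 𝔽. Then for every subset J ⊆ {1,…,n} of size k+1 there exists a nonzero polynomial f of degree at most d with all coefficients in 𝔽, depending only on the variables indexed by J, that vanishes identically on V. -/
open MvPolynomial

/-! ### Descent of coefficients -/

/-- Apply an additive map to all coefficients. -/
noncomputable def coeffApply {F K : Type*} [Field F] [Field K] [Algebra F K] {n : ℕ}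
    (φ : K →ₗ[F] F) (f : MvPolynomial (Fin n) K) : MvPolynomial (Fin n) F :=
  ∑ m ∈ f.support, monomial m (φ (coeff m f))

theorem coeff_coeffApply {F K : Type*} [Field F] [Field K] [Algebra F K] {n : ℕ}
    (φ : K →ₗ[F] F) (f : MvPolynomial (Fin n) K) (m : Fin n →₀ ℕ) :
    coeff m (coeffApply φ f) = φ (coeff m f) := by
  classical
  unfold coeffApply
  rw [coeff_sum]
  simp only [coeff_monomial]
  rw [Finset.sum_ite_eq']
  split_ifs with h
  · rfl
  · rw [notMem_support_iff.mp h, map_zero]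

theorem descent_aux {F K : Type*} [Field F] [Field K] [Algebra F K] {n : ℕ}
    (s : Set (MvPolynomial (Fin n) F)) (f : MvPolynomial (Fin n) K)
    (hf : f ∈ Ideal.span ((MvPolynomial.map (algebraMap F K)) '' s)) (hf0 : f ≠ 0) :
    ∃ g : MvPolynomial (Fin n) F, g ≠ 0 ∧ g.support ⊆ f.support ∧ g ∈ Ideal.span s := by
  classical
  obtain ⟨m, hm⟩ := MvPolynomial.ne_zero_iff.mp hf0
  obtain ⟨φ, hφ⟩ : ∃ φ : Module.Dual F K, φ (coeff m f) ≠ 0 := by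
    by_contra! h
    exact hm ((Module.forall_dual_apply_eq_zero_iff F _).mp h)
  refine ⟨coeffApply φ f, ?_, ?_, ?_⟩
  · intro h
    apply hφ
    rw [← coeff_coeffApply, h, coeff_zero]
  · intro a ha
    rw [mem_support_iff] at ha ⊢
    rw [coeff_coeffApply] at ha
    intro h
    rw [h, map_zero] at ha
    exact ha rfl
  · have key : ∀ f ∈ Ideal.span ((MvPolynomial.map (algebraMap F K)) '' s),
        coeffApply φ f ∈ Ideal.span s := by
      intro f hf
      refine Submodule.span_induction ?_ ?_ ?_ ?_ hf (p := fun f _ => ∀ h : MvPolynomial (Fin n) K,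
        coeffApply φ (h * f) ∈ Ideal.span s) 1 |> fun h => by simpa using h
      · rintro _ ⟨g, hg, rfl⟩ h
        have : coeffApply φ (h * MvPolynomial.map (algebraMap F K) g) = coeffApply φ h * g := by
          ext a
          rw [coeff_coeffApply, coeff_mul, coeff_mul, map_sum]
          refine Finset.sum_congr rfl fun b _ => ?_
          rw [coeff_map, coeff_coeffApply, mul_comm, ← Algebra.smul_def, map_smul, smul_eq_mul,
            mul_comm]
        rw [this]
        exact Ideal.mul_mem_left _ _ (Ideal.subset_span hg)
      · intro h
        have : coeffApply φ (h * 0) = 0 := by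
          ext a
          rw [coeff_coeffApply]; simp
        rw [this]; exact zero_mem _
      · intro x y _ _ hx hy h
        have : coeffApply φ (h * (x + y)) = coeffApply φ (h * x) + coeffApply φ (h * y) := by
          ext a
          rw [coeff_add]
          simp only [coeff_coeffApply]
          rw [mul_add, coeff_add, map_add]
        rw [this]; exact add_mem (hx h) (hy h)
      · intro a x _ hx h
        rw [smul_eq_mul, ← mul_assoc]
        exact hx _
    exact key f hf

/-! ### Zariski topology -/

theorem mem_vI {K : Type*} [Field K] {n : ℕ} {V : Set (Fin n → K)}
    {f : MvPolynomial (Fin n) K} :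
    f ∈ _root_.vanishingIdeal K n V ↔ ∀ x ∈ V, eval x f = 0 := Iff.rfl

theorem vI_anti {K : Type*} [Field K] {n : ℕ} {V W : Set (Fin n → K)} (h : V ⊆ W) :
    _root_.vanishingIdeal K n W ≤ _root_.vanishingIdeal K n V := fun _ hf x hx => hf x (h hx)

theorem zL_isClosed {K : Type*} [Field K] {n : ℕ} (S : Set (MvPolynomial (Fin n) K)) :
    IsClosed (_root_.zeroLocus K n S) := by
  rw [← isOpen_compl_iff]
  exact TopologicalSpace.isOpen_generateFrom_of_mem ⟨S, rfl⟩

theorem zL_vI_of_isClosed {K : Type*} [Field K] {n : ℕ} {V : Set (Fin n → K)} (hV : IsClosed V) :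
    _root_.zeroLocus K n (_root_.vanishingIdeal K n V : Set (MvPolynomial (Fin n) K)) = V := by
  suffices H : ∀ U : Set (Fin n → K), IsOpen U → ∀ x ∈ U,
      ∃ f : MvPolynomial (Fin n) K, (∀ y ∉ U, eval y f = 0) ∧ eval x f ≠ 0 by
    apply Set.Subset.antisymm
    · intro x hx
      by_contra hxV
      obtain ⟨f, hf, hfx⟩ := H Vᶜ hV.isOpen_compl x hxV
      exact hfx (hx f (fun y hy => hf y (by simpa using hy)))
    · intro x hx f hf
      exact hf x hx
  intro U hU
  induction hU with
  | basic s hs =>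
    obtain ⟨S, rfl⟩ := hs
    intro x hx
    have : ∃ f ∈ S, eval x f ≠ 0 := by
      by_contra! h
      exact hx h
    obtain ⟨f, hfS, hf⟩ := this
    exact ⟨f, fun y hy => (Set.notMem_compl_iff.mp hy) f hfS, hf⟩
  | univ => exact fun x _ => ⟨1, fun y hy => absurd (Set.mem_univ y) hy, by simp⟩
  | inter s t _ _ hs ht =>
    intro x hx
    obtain ⟨f, hf, hfx⟩ := hs x hx.1
    obtain ⟨g, hg, hgx⟩ := ht x hx.2
    refine ⟨f * g, fun y hy => ?_, by simp [hfx, hgx]⟩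
    by_cases h : y ∈ s
    · have : y ∉ t := fun h' => hy ⟨h, h'⟩
      simp [hg y this]
    · simp [hf y h]
  | sUnion S _ ih =>
    intro x hx
    obtain ⟨s, hs, hxs⟩ := hx
    obtain ⟨f, hf, hfx⟩ := ih s hs x hxs
    exact ⟨f, fun y hy => hf y (fun h => hy ⟨s, hs, h⟩), hfx⟩

theorem vI_zL_of_isPrime {K : Type*} [Field K] [IsAlgClosed K] {n : ℕ}
    (p : Ideal (MvPolynomial (Fin n) K)) [p.IsPrime] :
    _root_.vanishingIdeal K n (_root_.zeroLocus K n (p : Set (MvPolynomial (Fin n) K))) = p := by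
  have := MvPolynomial.IsPrime.vanishingIdeal_zeroLocus (K := K) p
  ext f
  rw [← Ideal.ext_iff.mp this f]
  rfl

theorem vI_isPrime {K : Type*} [Field K] {n : ℕ} {V : Set (Fin n → K)} (hV : IsIrreducible V) :
    (_root_.vanishingIdeal K n V).IsPrime := by
  refine ⟨?_, ?_⟩
  · rw [Ne, Ideal.eq_top_iff_one]
    intro h
    obtain ⟨x, hx⟩ := hV.1
    simpa using h x hx
  · intro a b hab
    have := isPreirreducible_iff_isClosed_union_isClosed.mp hV.2 _ _ (zL_isClosed {a})
      (zL_isClosed {b}) (by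
        intro x hx
        have := hab x hx
        rw [map_mul, mul_eq_zero] at this
        simpa [_root_.zeroLocus] using this)
    refine this.imp ?_ ?_ <;>
    · intro h x hx
      exact h hx _ rfl

theorem zL_isIrreducible {K : Type*} [Field K] [IsAlgClosed K] {n : ℕ}
    (p : Ideal (MvPolynomial (Fin n) K)) [hp : p.IsPrime] :
    IsIrreducible (_root_.zeroLocus K n (p : Set (MvPolynomial (Fin n) K))) := by
  refine ⟨?_, ?_⟩
  · by_contra h
    rw [Set.not_nonempty_iff_eq_empty] at h
    have := vI_zL_of_isPrime p
    rw [h] at this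
    apply hp.ne_top
    rw [← this, Ideal.eq_top_iff_one]
    intro x hx
    exact absurd hx (Set.notMem_empty x)
  · rw [isPreirreducible_iff_isClosed_union_isClosed]
    intro z₁ z₂ h₁ h₂ h
    rw [← zL_vI_of_isClosed h₁, ← zL_vI_of_isClosed h₂] at h ⊢
    have hle : _root_.vanishingIdeal K n z₁ * _root_.vanishingIdeal K n z₂ ≤ p := by
      rw [Ideal.mul_le]
      intro r hr s hs
      rw [← vI_zL_of_isPrime p]
      intro x hx
      rcases h hx with h | h
      · simp [h r hr]
      · simp [h s hs]
    refine (hp.mul_le.mp hle).imp ?_ ?_ <;>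
    · intro hle x hx f hf
      exact hx f (hle hf)

theorem vdim_eq_ringKrullDim {K : Type*} [Field K] [IsAlgClosed K] {n : ℕ} {W : Set (Fin n → K)}
    (hW : IsClosed W) :
    vdim K n W = ringKrullDim (MvPolynomial (Fin n) K ⧸ _root_.vanishingIdeal K n W) := by
  rw [ringKrullDim_quotient, ← Order.krullDim_orderDual, vdim, topologicalKrullDim]
  have hcl : ∀ Z : TopologicalSpace.IrreducibleCloseds ↥W,
      IsClosed (Subtype.val '' (Z : Set ↥W)) := fun Z =>
    hW.isClosedEmbedding_subtypeVal.isClosedMap _ Z.isClosed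
  have hirr : ∀ Z : TopologicalSpace.IrreducibleCloseds ↥W,
      IsIrreducible (Subtype.val '' (Z : Set ↥W)) := fun Z =>
    Z.isIrreducible.image _ continuous_subtype_val.continuousOn
  apply le_antisymm
  · refine Order.krullDim_le_of_strictMono
      (fun Z => OrderDual.toDual ⟨⟨_root_.vanishingIdeal K n (Subtype.val '' (Z : Set ↥W)),
        vI_isPrime (hirr Z)⟩, ?_⟩) ?_
    · exact vI_anti (by rintro _ ⟨x, _, rfl⟩; exact x.2)
    · intro Z Z' hZ
      refine lt_of_le_not_ge ?_ ?_
      · exact vI_anti (V := Subtype.val '' (Z : Set ↥W)) (W := Subtype.val '' (Z' : Set ↥W))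
          (Set.image_mono hZ.le)
      · intro h
        apply hZ.not_ge
        have h' : _root_.vanishingIdeal K n (Subtype.val '' (Z : Set ↥W)) ≤
          _root_.vanishingIdeal K n (Subtype.val '' (Z' : Set ↥W)) := h
        have : Subtype.val '' (Z' : Set ↥W) ⊆ Subtype.val '' (Z : Set ↥W) := by
          rw [← zL_vI_of_isClosed (hcl Z)]
          intro x hx f hf
          exact h' hf x hx
        intro x hx
        exact (Set.image_subset_image_iff Subtype.val_injective).mp this hx
  · have hsub : ∀ p : PrimeSpectrum.zeroLocus
        (_root_.vanishingIdeal K n W : Set (MvPolynomial (Fin n) K)),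
        _root_.zeroLocus K n (p.1.asIdeal : Set (MvPolynomial (Fin n) K)) ⊆ W := by
      intro p x hx
      rw [← zL_vI_of_isClosed hW]
      intro f hf
      exact hx f (p.2 hf)
    refine Order.krullDim_le_of_strictMono
      (fun p => ⟨Subtype.val ⁻¹' (_root_.zeroLocus K n
        ((OrderDual.ofDual p).1.asIdeal : Set (MvPolynomial (Fin n) K))), ?_, ?_⟩) ?_
    · have hi := zL_isIrreducible (OrderDual.ofDual p).1.asIdeal
      have hs := hsub (OrderDual.ofDual p)
      refine ⟨?_, ?_⟩
      · obtain ⟨x, hx⟩ := hi.1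
        exact ⟨⟨x, hs hx⟩, hx⟩
      · intro u v hu hv hu' hv'
        obtain ⟨u, huo, rfl⟩ := isOpen_induced_iff.mp hu
        obtain ⟨v, hvo, rfl⟩ := isOpen_induced_iff.mp hv
        obtain ⟨x, hx, hxu⟩ := hu'
        obtain ⟨y, hy, hyv⟩ := hv'
        obtain ⟨z, hz, hzu⟩ := hi.2 u v huo hvo ⟨x, hx, hxu⟩ ⟨y, hy, hyv⟩
        exact ⟨⟨z, hs hz⟩, hz, hzu⟩
    · exact (zL_isClosed _).preimage continuous_subtype_val
    · intro p q hpq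
      have hlt : (OrderDual.ofDual q).1.asIdeal < (OrderDual.ofDual p).1.asIdeal := hpq
      refine lt_of_le_not_ge ?_ ?_
      · intro x hx f hf
        exact hx f (hlt.le hf)
      · intro h
        apply hlt.not_ge
        rw [← vI_zL_of_isPrime (OrderDual.ofDual q).1.asIdeal,
          ← vI_zL_of_isPrime (OrderDual.ofDual p).1.asIdeal]
        apply vI_anti
        intro x hx
        have hs := hsub (OrderDual.ofDual p)
        have hxW : x ∈ W := hsub (OrderDual.ofDual q) hx
        have h2 : (Subtype.val ⁻¹' (_root_.zeroLocus K n ((OrderDual.ofDual q).1.asIdeal :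
          Set (MvPolynomial (Fin n) K))) : Set ↥W) ⊆ Subtype.val ⁻¹' (_root_.zeroLocus K n
          ((OrderDual.ofDual p).1.asIdeal : Set (MvPolynomial (Fin n) K))) := h
        exact @h2 ⟨x, hxW⟩ hx

theorem noetherian_zariski {K : Type*} [Field K] {n : ℕ} :
    TopologicalSpace.NoetherianSpace (Fin n → K) := by
  refine ((TopologicalSpace.noetherianSpace_TFAE (Fin n → K)).out 0 1 :
    TopologicalSpace.NoetherianSpace (Fin n → K) ↔
      WellFoundedLT (TopologicalSpace.Closeds (Fin n → K))).mpr ?_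
  have : StrictAnti (fun Z : TopologicalSpace.Closeds (Fin n → K) =>
      _root_.vanishingIdeal K n (Z : Set (Fin n → K))) := by
    intro Z Z' hZ
    refine lt_of_le_not_ge (vI_anti hZ.le) ?_
    intro h
    apply hZ.not_ge
    have : (Z' : Set (Fin n → K)) ⊆ Z := by
      rw [← zL_vI_of_isClosed Z.isClosed]
      intro x hx f hf
      exact h hf x hx
    exact this
  exact this.wellFoundedLT

/-! ### Krull dimension and transcendence degree -/

theorem ringKrullDim_eq_of_integral {R S : Type*} [CommRing R] [CommRing S] [Algebra R S]
    [Algebra.IsIntegral R S] [FaithfulSMul R S] : ringKrullDim S = ringKrullDim R := by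
  apply le_antisymm
  · refine Order.krullDim_le_of_strictMono (PrimeSpectrum.comap (algebraMap R S)) ?_
    intro p q hpq
    exact Ideal.IsIntegral.comap_lt_comap (I := p.asIdeal) (J := q.asIdeal) hpq
  · unfold ringKrullDim
    rw [Order.krullDim]
    refine iSup_le fun l => ?_
    obtain ⟨Q, hQ⟩ := Ideal.nonempty_primesOver (S := S) (RelSeries.head l).asIdeal
    have := hQ.1
    have := hQ.2
    obtain ⟨L, hL, -⟩ := Ideal.exists_ltSeries_of_hasGoingUp (S := S) l Q
    rw [← hL]
    exact Order.LTSeries.length_le_krullDim L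

theorem ringKrullDim_eq_card {K A : Type*} [Field K] [CommRing A] [IsDomain A] [Algebra K A]
    [Algebra.FiniteType K A] {ι : Type} [Finite ι] (x : ι → A) (hx : IsTranscendenceBasis K x) :
    ringKrullDim A = (Nat.card ι : WithBot ℕ∞) := by
  obtain ⟨s, g, hg, hgi⟩ := exists_integral_inj_algHom_of_fg K A
  have hy : AlgebraicIndependent K (fun i : Fin s => g (X i)) := by
    have : aeval (fun i : Fin s => g (X i)) = g := by ext; simp
    rw [AlgebraicIndependent, this]; exact hg
  have hy' : IsTranscendenceBasis K (fun i : Fin s => g (X i)) := by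
    rw [hy.isTranscendenceBasis_iff_isAlgebraic]
    constructor
    intro a
    have hyInt : IsIntegral (Algebra.adjoin K (Set.range fun i : Fin s => g (X i))) a := by
      obtain ⟨p, hp, hpa⟩ := hgi a
      refine ⟨p.map (g.codRestrict _ ?_).toRingHom, hp.map _, ?_⟩
      · intro q
        have : aeval (fun i : Fin s => g (X i)) q = g q := by
          congr 1; ext; simp
        rw [← this]
        rw [Algebra.adjoin_range_eq_range_aeval]
        exact ⟨q, rfl⟩
      · rw [Polynomial.eval₂_map]
        exact hpa
    exact hyInt.isAlgebraic
  have hcard : Nat.card ι = s := by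
    have := hx.cardinalMk_eq hy'
    have := congrArg Cardinal.toNat this
    simpa [Nat.card] using this
  let _ := g.toRingHom.toAlgebra
  have : Algebra.IsIntegral (MvPolynomial (Fin s) K) A := ⟨hgi⟩
  have : FaithfulSMul (MvPolynomial (Fin s) K) A :=
    (faithfulSMul_iff_algebraMap_injective _ _).mpr hg
  rw [ringKrullDim_eq_of_integral (R := MvPolynomial (Fin s) K),
    MvPolynomial.ringKrullDim_of_isNoetherianRing, ringKrullDim_eq_zero_of_field, hcard]
  simp

/-! ### Generic directions -/

theorem exists_pderiv_ne_zero {K : Type*} [Field K] [IsAlgClosed K] {n : ℕ}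
    {f : MvPolynomial (Fin n) K} (hf : Irreducible f) : ∃ i, pderiv i f ≠ 0 := by
  classical
  by_contra! h
  have hm : ∀ m ∈ f.support, ∀ i, ((m i : ℕ) : K) = 0 := by
    intro m hm i
    by_cases hmi : m i = 0
    · simp [hmi]
    have h1 : coeff (m - Finsupp.single i 1) (pderiv i f) = coeff m f * (m i : K) := by
      conv_lhs => rw [f.as_sum]
      rw [map_sum, coeff_sum]
      simp only [pderiv_monomial, coeff_monomial]
      rw [Finset.sum_eq_single m]
      · simp
      · intro b hb hbm
        split_ifs with hE
        · by_cases hbi : b i = 0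
          · simp [hbi]
          · exfalso
            apply hbm
            ext k
            have := DFunLike.congr_fun hE k
            simp only [Finsupp.coe_tsub, Pi.sub_apply] at this
            by_cases hk : i = k
            · subst hk
              simp at this
              omega
            · simpa [Finsupp.single_apply, hk] using this
        · rfl
      · intro h; exact absurd hm h
    rw [h i, coeff_zero] at h1
    rcases mul_eq_zero.mp h1.symm with h2 | h2
    · exact absurd h2 (mem_support_iff.mp hm)
    · exact h2
  obtain ⟨p, hp⟩ := ExpChar.exists K
  cases hp with
  | zero =>
    apply hf.not_isUnit
    have : f = C (coeff 0 f) := by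
      ext m
      rw [coeff_C]
      split_ifs with h0
      · rw [h0]
      · by_contra hne
        apply h0
        ext i
        have := hm m (mem_support_iff.mpr hne) i
        simpa using (Nat.cast_eq_zero.mp this).symm
    rw [this]
    have hne : coeff 0 f ≠ 0 := by
      intro h0
      rw [h0, C_0] at this
      exact hf.ne_zero this
    exact (IsUnit.mk0 _ hne).map C
  | prime hprime =>
    have := Fact.mk hprime
    have hdvd : ∀ m ∈ f.support, ∀ i, p ∣ m i := fun m h' i =>
      (CharP.cast_eq_zero_iff K p _).mp (hm m h' i)
    have hroot : ∀ c : K, ∃ r : K, r ^ p = c := fun c =>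
      IsAlgClosed.exists_pow_nat_eq c hprime.pos
    choose r hr using hroot
    have hpow : f = (∑ m ∈ f.support,
        monomial (m.mapRange (· / p) (Nat.zero_div p)) (r (coeff m f))) ^ p := by
      rw [sum_pow_char]
      conv_lhs => rw [f.as_sum]
      refine Finset.sum_congr rfl fun m hm' => ?_
      rw [monomial_pow, hr]
      have hE : p • m.mapRange (· / p) (Nat.zero_div p) = m := by
        ext i
        simp only [Finsupp.coe_smul, Pi.smul_apply, Finsupp.mapRange_apply, smul_eq_mul]
        exact Nat.mul_div_cancel' (hdvd m hm' i)
      rw [hE]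
    rw [hpow] at hf
    exact not_irreducible_pow hprime.ne_one hf

theorem exists_direction {K : Type*} [Field K] [IsAlgClosed K] {n : ℕ}
    {f : MvPolynomial (Fin n) K} (hf : Irreducible f) (j : Fin n) :
    ∃ u : Fin n → K, u j ≠ 0 ∧ eval u (homogeneousComponent f.totalDegree f) ≠ 0 ∧
      ∑ i, C (u i) * pderiv i f ≠ 0 := by
  classical
  obtain ⟨i₀, hi₀⟩ := exists_pderiv_ne_zero hf
  obtain ⟨m, hm⟩ := MvPolynomial.ne_zero_iff.mp hi₀
  let ℓ : MvPolynomial (Fin n) K := ∑ i, C (coeff m (pderiv i f)) * X i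
  have hℓ : ℓ ≠ 0 := by
    intro h
    have : eval (Pi.single i₀ 1) ℓ = coeff m (pderiv i₀ f) := by
      simp [ℓ, Pi.single_apply]
    rw [h, map_zero] at this
    exact hm this.symm
  have hh : homogeneousComponent f.totalDegree f ≠ 0 := by
    obtain ⟨b, hb, hb'⟩ := Finset.exists_mem_eq_sup f.support
      (by rw [Finset.nonempty_iff_ne_empty, Ne, support_eq_empty]; exact hf.ne_zero)
      (fun s => s.sum fun _ e => e)
    intro h
    have h1 : coeff b (homogeneousComponent f.totalDegree f) = coeff b f := by
      rw [coeff_homogeneousComponent, if_pos]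
      exact hb'.symm
    rw [h, coeff_zero] at h1
    exact (mem_support_iff.mp hb) h1.symm
  have hprod : homogeneousComponent f.totalDegree f * X j * ℓ ≠ 0 :=
    mul_ne_zero (mul_ne_zero hh (X_ne_zero j)) hℓ
  obtain ⟨u, hu⟩ : ∃ u : Fin n → K, eval u (homogeneousComponent f.totalDegree f * X j * ℓ) ≠ 0 := by
    by_contra! h
    exact hprod (MvPolynomial.funext fun x => by simpa using h x)
  rw [map_mul, map_mul, eval_X] at hu
  refine ⟨u, ?_, ?_, ?_⟩
  · intro h; simp [h] at hu
  · intro h; simp [h] at hu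
  · intro h
    have : eval u ℓ = 0 := by
      have := congrArg (coeff m) h
      rw [coeff_sum, coeff_zero] at this
      simp only [coeff_C_mul] at this
      simp only [ℓ, map_sum, map_mul, eval_C, eval_X]
      rw [← this]
      exact Finset.sum_congr rfl fun _ _ => mul_comm _ _
    simp [this] at hu

theorem coeff_prod_of_natDegree_le_sum {R ι : Type*} [CommRing R] (s : Finset ι)
    (w : ι → Polynomial R) (d : ι → ℕ) (h : ∀ i ∈ s, (w i).natDegree ≤ d i) :
    (∏ i ∈ s, w i).coeff (∑ i ∈ s, d i) = ∏ i ∈ s, (w i).coeff (d i) := by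
  classical
  induction s using Finset.induction_on with
  | empty => simp
  | insert a s ha ih =>
    rw [Finset.prod_insert ha, Finset.prod_insert ha, Finset.sum_insert ha,
      Polynomial.coeff_mul_add_eq_of_natDegree_le (h a (Finset.mem_insert_self a s)),
      ih fun i hi => h i (Finset.mem_insert_of_mem hi)]
    exact (Polynomial.natDegree_prod_le _ _).trans
      (Finset.sum_le_sum fun i hi => h i (Finset.mem_insert_of_mem hi))

theorem line_restrict {K P : Type*} [Field K] [CommRing P] [Algebra K P] {n : ℕ}
    (a : Fin n → P) (u : Fin n → K) (f : MvPolynomial (Fin n) K) :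
    (aeval (fun i => Polynomial.C (a i) + Polynomial.C (algebraMap K P (u i)) * Polynomial.X)
      f).natDegree ≤ f.totalDegree ∧
    (aeval (fun i => Polynomial.C (a i) + Polynomial.C (algebraMap K P (u i)) * Polynomial.X)
      f).coeff f.totalDegree = algebraMap K P (eval u (homogeneousComponent f.totalDegree f)) := by
  classical
  set w : Fin n → Polynomial P := fun i =>
    Polynomial.C (a i) + Polynomial.C (algebraMap K P (u i)) * Polynomial.X with hw
  have hw1 : ∀ i, (w i).natDegree ≤ 1 := by
    intro i
    simp only [hw]
    compute_degree
  have hmon : ∀ m : Fin n →₀ ℕ, (∏ i, w i ^ m i).natDegree ≤ m.degree ∧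
      (∏ i, w i ^ m i).coeff m.degree = algebraMap K P (∏ i, u i ^ m i) := by
    intro m
    have hd : m.degree = ∑ i, m i := Finsupp.degree_eq_sum m
    have hpw : ∀ i, (w i ^ m i).natDegree ≤ m i := fun i =>
      (Polynomial.natDegree_pow_le_of_le (m i) (hw1 i)).trans (by simp)
    rw [hd]
    refine ⟨(Polynomial.natDegree_prod_le _ _).trans (Finset.sum_le_sum fun i _ => hpw i), ?_⟩
    rw [coeff_prod_of_natDegree_le_sum _ _ _ (fun i _ => hpw i), map_prod]
    refine Finset.prod_congr rfl fun i _ => ?_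
    have := Polynomial.coeff_pow_of_natDegree_le (m := m i) (hw1 i)
    rw [mul_one] at this
    rw [this, map_pow]
    congr 1
    simp [hw]
  have hexp : aeval w f = ∑ m ∈ f.support,
      Polynomial.C (algebraMap K P (coeff m f)) * ∏ i, w i ^ m i := by
    rw [aeval_def, eval₂_eq']
    rfl
  have hdeg : ∀ m ∈ f.support, m.degree ≤ f.totalDegree := fun m hm => le_totalDegree hm
  refine ⟨?_, ?_⟩
  · rw [hexp]
    refine Polynomial.natDegree_sum_le_of_forall_le _ _ fun m hm => ?_
    exact (Polynomial.natDegree_C_mul_le _ _).trans ((hmon m).1.trans (hdeg m hm))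
  · rw [hexp, Polynomial.finsetSum_coeff, homogeneousComponent_apply, map_sum, map_sum,
      Finset.sum_filter]
    refine Finset.sum_congr rfl fun m hm => ?_
    rw [Polynomial.coeff_C_mul]
    split_ifs with h
    · rw [← h, (hmon m).2, ← map_mul, eval_monomial]
      congr 2
      exact (Finsupp.prod_fintype _ _ (by simp)).symm
    · rw [Polynomial.coeff_eq_zero_of_natDegree_lt, mul_zero]
      exact lt_of_le_of_lt (hmon m).1 (lt_of_le_of_ne (hdeg m hm) h)

/-! ### Transcendence bases among the coordinates -/

theorem isAlgebraic_of_gens {K A : Type*} [Field K] [CommRing A] [IsDomain A] [Algebra K A]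
    {ι : Type*} (ξ : ι → A) (hgen : Algebra.adjoin K (Set.range ξ) = ⊤) (S : Subalgebra K A)
    (h : ∀ i, IsAlgebraic S (ξ i)) : Algebra.IsAlgebraic S A := by
  constructor
  intro a
  have ha : a ∈ Algebra.adjoin K (Set.range ξ) := by rw [hgen]; trivial
  induction ha using Algebra.adjoin_induction with
  | mem x hx => obtain ⟨i, rfl⟩ := hx; exact h i
  | algebraMap r => exact isAlgebraic_algebraMap (⟨algebraMap K A r, S.algebraMap_mem r⟩ : S)
  | add x y _ _ hx hy => exact hx.add hy
  | mul x y _ _ hx hy => exact hx.mul hy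

theorem exists_coord_basis {K A : Type*} [Field K] [CommRing A] [IsDomain A] [Algebra K A]
    [Algebra.FiniteType K A] {n : ℕ} (ξ : Fin n → A)
    (hgen : Algebra.adjoin K (Set.range ξ) = ⊤) (J : Finset (Fin n))
    (hJ : ringKrullDim A < (J.card : WithBot ℕ∞)) :
    ∃ (B : Finset (Fin n)) (j : Fin n), j ∉ B ∧
      IsTranscendenceBasis K (fun i : B => ξ i) ∧ ringKrullDim A = (B.card : WithBot ℕ∞) ∧
      ∃ q : MvPolynomial (Fin n) K, q ≠ 0 ∧ q.vars ⊆ J ∧ q.vars ⊆ insert j B ∧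
        aeval ξ q = 0 := by
  classical
  let good : Finset (Fin n) → Prop := fun s => AlgebraicIndepOn K ξ (s : Set (Fin n))
  have hgood0 : good ∅ := by
    simp only [good, Finset.coe_empty]
    rw [AlgebraicIndepOn, algebraicIndependent_empty_type_iff]
    exact (algebraMap K A).injective
  obtain ⟨B₀, hB₀⟩ := ((Finset.univ : Finset (Finset (Fin n))).filter
    (fun s => good s ∧ s ⊆ J)).exists_maximal ⟨∅, by simp [hgood0]⟩
  obtain ⟨B, hBB, hB⟩ := ((Finset.univ : Finset (Finset (Fin n))).filter
    (fun s => good s)).exists_le_maximal (a := B₀) (by simpa using (by simpa using hB₀.1 : good B₀ ∧ B₀ ⊆ J).1)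
  have hB₀g : good B₀ ∧ B₀ ⊆ J := by simpa using hB₀.1
  have hBg : good B := by simpa using hB.1
  have hBt : IsTranscendenceBasis K (fun i : B => ξ i) := by
    have hBg' : AlgebraicIndependent K (fun i : B => ξ i) := hBg
    rw [hBg'.isTranscendenceBasis_iff_isAlgebraic]
    apply isAlgebraic_of_gens ξ hgen
    have hr : (Set.range fun i : B => ξ i) = ξ '' (B : Set (Fin n)) := by
      ext; simp
    rw [hr]
    intro i
    by_cases hi : i ∈ B
    · exact isAlgebraic_algebraMap (⟨ξ i, Algebra.subset_adjoin ⟨i, hi, rfl⟩⟩ :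
        Algebra.adjoin K (ξ '' (B : Set (Fin n))))
    · by_contra hcon
      have h1 : good (insert i B) := by
        simp only [good, Finset.coe_insert]
        exact (AlgebraicIndepOn.insert_iff (by simpa using hi)).mpr ⟨hBg, hcon⟩
      have := hB.2 (y := insert i B) (by simpa using h1) (Finset.subset_insert i B)
      exact hi (this (Finset.mem_insert_self i B))
  have hcard := ringKrullDim_eq_card _ hBt
  rw [Nat.card_eq_fintype_card, Fintype.card_coe] at hcard
  have hlt : B.card < J.card := by
    rw [hcard] at hJ; exact_mod_cast hJ
  obtain ⟨j, hjJ, hjB⟩ : ∃ j ∈ J, j ∉ B₀ := by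
    by_contra! hc
    exact absurd (Finset.card_le_card (Finset.Subset.trans hc hBB)) (not_le.mpr hlt)
  have hng : ¬ good (insert j B₀) := by
    intro h1
    have := hB₀.2 (y := insert j B₀) (by
      simp only [Finset.mem_filter, Finset.mem_univ, true_and]
      exact ⟨h1, Finset.insert_subset hjJ hB₀g.2⟩) (Finset.subset_insert j B₀)
    exact hjB (this (Finset.mem_insert_self j B₀))
  have hjB' : j ∉ B := by
    intro hj
    apply hng
    exact AlgebraicIndepOn.mono hBg (by
      intro x hx
      rcases Finset.mem_insert.mp hx with rfl | hx
      · exact hj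
      · exact hBB hx)
  refine ⟨B, j, hjB', hBt, hcard, ?_⟩
  have hni : ¬ Function.Injective (aeval (R := K) (fun i : ((insert j B₀ : Finset (Fin n)) : Set (Fin n)) => ξ i)) := hng
  rw [injective_iff_map_eq_zero] at hni
  push Not at hni
  obtain ⟨q, hq0, hq1⟩ := hni
  have hv : (rename Subtype.val q).vars ⊆ insert j B₀ := by
    refine (vars_rename _ _).trans ?_
    intro x hx
    obtain ⟨y, -, rfl⟩ := Finset.mem_image.mp hx
    exact y.2
  refine ⟨rename Subtype.val q, ?_, hv.trans (Finset.insert_subset hjJ hB₀g.2),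
    hv.trans (Finset.insert_subset_insert j hBB), ?_⟩
  · intro h
    exact hq1 (rename_injective _ Subtype.val_injective (by rw [h, map_zero]))
  · rw [aeval_rename]; exact hq0

/-! ### Irreducible factors and fibres -/

theorem exists_irred_factor {K : Type*} [Field K] {n : ℕ} (p : Ideal (MvPolynomial (Fin n) K))
    [hp : p.IsPrime] (q : MvPolynomial (Fin n) K) (hq0 : q ≠ 0) (hq : q ∈ p) :
    ∃ f, Irreducible f ∧ f ∈ p ∧ f.vars ⊆ q.vars := by
  classical
  obtain ⟨s, hs, hsq⟩ := UniqueFactorizationMonoid.exists_prime_factors q hq0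
  have hsp : s.prod ∈ p := by
    obtain ⟨c, hc⟩ := hsq.symm
    rw [← hc]
    exact p.mul_mem_right _ hq
  obtain ⟨f, hfs, hfp⟩ := (hp.multiset_prod_mem_iff_exists_mem s).mp hsp
  refine ⟨f, (hs f hfs).irreducible, hfp, ?_⟩
  obtain ⟨g, hg⟩ := (Multiset.dvd_prod hfs).trans hsq.dvd
  intro i hi
  rw [vars_def, Multiset.mem_toFinset, ← Multiset.count_ne_zero, ← degreeOf_def] at hi ⊢
  have hf0 : f ≠ 0 := (hs f hfs).ne_zero
  have hg0 : g ≠ 0 := by rintro rfl; exact hq0 (by simpa using hg)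
  rw [hg, degreeOf_mul_eq hf0 hg0]
  omega

theorem fibre_ne_top {P A K : Type*} [CommRing P] [IsDomain P] [IsIntegrallyClosed P]
    [CommRing A] [IsDomain A] [Algebra P A] [FaithfulSMul P A] [Field K]
    (y : A) (hy : IsIntegral P y) (v : P) (hv : ∀ a : A, ∃ N : ℕ, IsIntegral P (v ^ N • a))
    (α : P →+* K) (hαv : α v ≠ 0) (y₀ : K) (hroot : (minpoly P y).eval₂ α y₀ = 0) :
    (RingHom.ker (Polynomial.eval₂RingHom α y₀)).map
      (Polynomial.aeval (R := P) y).toRingHom ≠ ⊤ := by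
  set q₀ := RingHom.ker (Polynomial.eval₂RingHom α y₀) with hq₀
  have hq₀p : q₀.IsPrime := RingHom.ker_isPrime _
  let y' : integralClosure P A := ⟨y, hy⟩
  let g : Polynomial P →+* integralClosure P A := (Polynomial.aeval (R := P) y').toRingHom
  have hgy : ∀ h, ((g h : integralClosure P A) : A) = Polynomial.aeval y h := by
    intro h
    exact (Polynomial.aeval_algHom_apply (integralClosure P A).val y' h).symm
  obtain ⟨Q, hQp, hQc⟩ : ∃ Q : Ideal (integralClosure P A), Q.IsPrime ∧ Q.comap g = q₀ := by
    let _ := g.toAlgebra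
    have : Algebra.IsIntegral (Polynomial P) (integralClosure P A) := by
      constructor
      intro x
      have hx : IsIntegral P x := Algebra.IsIntegral.isIntegral x
      obtain ⟨r, hr, hrx⟩ := hx
      refine ⟨r.map Polynomial.C, hr.map _, ?_⟩
      rw [Polynomial.eval₂_map]
      rw [← hrx]
      congr 1
      ext z
      change ((g (Polynomial.C z) : integralClosure P A) : A) = _
      rw [hgy]
      simp
    obtain ⟨Q, -, hQ, hQ'⟩ := Ideal.exists_ideal_over_prime_of_isIntegral q₀
      (⊥ : Ideal (integralClosure P A)) (by
        intro h hh
        have h1 : g h = 0 := hh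
        have h2 : Polynomial.aeval y h = 0 := by rw [← hgy, h1]; rfl
        obtain ⟨k, hk⟩ := minpoly.isIntegrallyClosed_dvd hy h2
        rw [hq₀, RingHom.mem_ker, hk, map_mul]
        rw [Polynomial.coe_eval₂RingHom, hroot, zero_mul])
    exact ⟨Q, hQ, hQ'⟩
  intro htop
  have key : ∀ z ∈ q₀.map (Polynomial.aeval (R := P) y).toRingHom,
      ∃ (N : ℕ) (s : integralClosure P A), s ∈ Q ∧ (s : A) = v ^ N • z := by
    intro z hz
    induction hz using Submodule.span_induction with
    | mem x hx =>
      obtain ⟨h, hh, rfl⟩ := hx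
      refine ⟨0, g h, ?_, ?_⟩
      · rw [← Ideal.mem_comap, hQc]; exact hh
      · rw [hgy]; simp
    | zero => exact ⟨0, 0, Q.zero_mem, by simp⟩
    | add a b _ _ ha hb =>
      obtain ⟨N, s, hs, hs'⟩ := ha
      obtain ⟨M, t, ht, ht'⟩ := hb
      refine ⟨N + M, v ^ M • s + v ^ N • t, ?_, ?_⟩
      · exact Q.add_mem (Submodule.smul_of_tower_mem Q _ hs) (Submodule.smul_of_tower_mem Q _ ht)
      · push_cast
        rw [hs', ht', smul_smul, smul_smul, smul_add, ← pow_add, ← pow_add, add_comm M N]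
    | smul a b _ hb =>
      obtain ⟨N, s, hs, hs'⟩ := hb
      obtain ⟨M, hM⟩ := hv a
      refine ⟨M + N, (⟨v ^ M • a, hM⟩ : integralClosure P A) * s, Q.mul_mem_left _ hs, ?_⟩
      push_cast
      rw [hs', smul_mul_smul_comm, ← pow_add, smul_eq_mul]
  obtain ⟨N, s, hs, hs'⟩ := key 1 (by rw [htop]; trivial)
  have hsg : s = g (Polynomial.C v) ^ N := by
    apply Subtype.ext
    rw [hs', SubmonoidClass.coe_pow, hgy, Algebra.smul_def]
    simp
  rw [hsg] at hs
  have h1 : Polynomial.C v ∈ q₀ := by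
    rw [← hQc]; exact hQp.mem_of_pow_mem _ hs
  rw [hq₀, RingHom.mem_ker] at h1
  apply hαv
  simpa using h1

/-! ### The linear change of coordinates -/

/-- The linear forms `x_i - (u_i / u_j) x_j` as an algebra map. -/
noncomputable def linSub {K : Type*} [Field K] {n : ℕ} (B : Finset (Fin n)) (j : Fin n)
    (u : Fin n → K) : MvPolynomial B K →ₐ[K] MvPolynomial (Fin n) K :=
  aeval (fun i : B => X i.1 - C (u i.1 * (u j)⁻¹) * X j)

/-- Extension of `linSub` sending the extra variable to `x_j / u_j`. -/
noncomputable def psiHom {K : Type*} [Field K] {n : ℕ} (B : Finset (Fin n)) (j : Fin n)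
    (u : Fin n → K) : Polynomial (MvPolynomial B K) →+* MvPolynomial (Fin n) K :=
  Polynomial.eval₂RingHom (linSub B j u).toRingHom (C (u j)⁻¹ * X j)

/-- Restriction to the line in direction `u` through a generic point. -/
noncomputable def thetaHom {K : Type*} [Field K] {n : ℕ} (B : Finset (Fin n))
    (u : Fin n → K) : MvPolynomial (Fin n) K →ₐ[K] Polynomial (MvPolynomial B K) :=
  aeval (fun i => Polynomial.C (if h : i ∈ B then X ⟨i, h⟩ else 0) +
    Polynomial.C (algebraMap K (MvPolynomial B K) (u i)) * Polynomial.X)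

theorem psiHom_C {K : Type*} [Field K] {n : ℕ} (B : Finset (Fin n)) (j : Fin n)
    (u : Fin n → K) (a : MvPolynomial B K) :
    psiHom B j u (Polynomial.C a) = linSub B j u a := by
  simp [psiHom]

theorem psiHom_X {K : Type*} [Field K] {n : ℕ} (B : Finset (Fin n)) (j : Fin n)
    (u : Fin n → K) : psiHom B j u Polynomial.X = C (u j)⁻¹ * X j := by
  simp [psiHom]

theorem psi_theta {K : Type*} [Field K] {n : ℕ} (B : Finset (Fin n)) (j : Fin n) (hj : j ∉ B)
    (u : Fin n → K) (hu : u j ≠ 0) (f : MvPolynomial (Fin n) K) (hf : f.vars ⊆ insert j B) :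
    psiHom B j u (thetaHom B u f) = f := by
  classical
  have : ((psiHom B j u).comp (thetaHom B u).toRingHom) f = (RingHom.id _) f := by
    apply hom_congr_vars
    · ext c
      simp [thetaHom, psiHom, Polynomial.algebraMap_apply, MvPolynomial.algebraMap_eq]
    · intro i hi _
      have hX : thetaHom B u (X i) = Polynomial.C (if h : i ∈ B then X ⟨i, h⟩ else 0) +
        Polynomial.C (algebraMap K (MvPolynomial B K) (u i)) * Polynomial.X := by
        simp [thetaHom]
      change psiHom B j u (thetaHom B u (X i)) = X i
      rw [hX, map_add, map_mul, psiHom_C, psiHom_C, psiHom_X, AlgHom.commutes,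
        MvPolynomial.algebraMap_eq, ← mul_assoc, ← C_mul]
      rcases Finset.mem_insert.mp (hf hi) with rfl | hiB
      · rw [dif_neg hj, map_zero, mul_inv_cancel₀ hu]
        simp
      · rw [dif_pos hiB]
        simp [linSub]
    · rfl
  exact this

theorem theta_psi {K : Type*} [Field K] {n : ℕ} (B : Finset (Fin n)) (j : Fin n) (hj : j ∉ B)
    (u : Fin n → K) (hu : u j ≠ 0) (g : Polynomial (MvPolynomial B K)) :
    thetaHom B u (psiHom B j u g) = g := by
  have hXj : thetaHom B u (X j) =
      Polynomial.C (algebraMap K (MvPolynomial B K) (u j)) * Polynomial.X := by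
    simp [thetaHom, hj]
  have hC : ∀ c : K, thetaHom B u (C c) = Polynomial.C (C c) := by
    intro c
    simp [thetaHom, Polynomial.algebraMap_apply, MvPolynomial.algebraMap_eq]
  have : (thetaHom B u).toRingHom.comp (psiHom B j u) = RingHom.id _ := by
    apply Polynomial.ringHom_ext'
    · apply MvPolynomial.ringHom_ext
      · intro c
        change thetaHom B u (psiHom B j u (Polynomial.C (C c))) = _
        rw [psiHom_C, linSub, aeval_C, MvPolynomial.algebraMap_eq, hC]
        rfl
      · intro i
        change thetaHom B u (psiHom B j u (Polynomial.C (X i))) = Polynomial.C (X i)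
        rw [psiHom_C, linSub, aeval_X, map_sub, map_mul, hXj, hC]
        have : thetaHom B u (X i.1) = Polynomial.C (X i) +
          Polynomial.C (C (u i)) * Polynomial.X := by
          simp [thetaHom, MvPolynomial.algebraMap_eq]
        rw [this, MvPolynomial.algebraMap_eq, ← mul_assoc, ← Polynomial.C_mul, ← C_mul,
          mul_assoc, inv_mul_cancel₀ hu, mul_one]
        ring
    · change thetaHom B u (psiHom B j u Polynomial.X) = Polynomial.X
      rw [psiHom_X, map_mul, hXj, hC, MvPolynomial.algebraMap_eq, ← mul_assoc, ← Polynomial.C_mul,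
        ← C_mul, inv_mul_cancel₀ hu]
      simp
  exact congrArg (fun h : _ →+* _ => h g) this

theorem deriv_psi {K : Type*} [Field K] {n : ℕ} (B : Finset (Fin n)) (j : Fin n)
    (u : Fin n → K) (hu : u j ≠ 0) (g : Polynomial (MvPolynomial B K)) :
    ∑ i, C (u i) * pderiv i (psiHom B j u g) = psiHom B j u (Polynomial.derivative g) := by
  classical
  let D : Derivation K (MvPolynomial (Fin n) K) (MvPolynomial (Fin n) K) :=
    ∑ i, (C (u i) : MvPolynomial (Fin n) K) • pderiv i
  have hD : ∀ f, D f = ∑ i, C (u i) * pderiv i f := by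
    intro f
    have h1 := map_sum (Derivation.coeFnAddMonoidHom (R := K) (A := MvPolynomial (Fin n) K)
      (M := MvPolynomial (Fin n) K))
      (fun i => (C (u i) : MvPolynomial (Fin n) K) • pderiv i) Finset.univ
    have h2 := congrFun h1 f
    rw [Finset.sum_apply] at h2
    exact h2
  have hDX : ∀ i, D (X i) = C (u i) := by
    intro i
    rw [hD, Finset.sum_eq_single i]
    · simp
    · intro b _ hb
      rw [pderiv_X_of_ne (Ne.symm hb), mul_zero]
    · simp
  have hDC : ∀ c : K, D (C c) = 0 := fun c => by
    rw [← MvPolynomial.algebraMap_eq]; exact D.map_algebraMap c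
  have hDlin : ∀ a, D (linSub B j u a) = 0 := by
    intro a
    induction a using MvPolynomial.induction_on with
    | C c => rw [linSub, aeval_C]; exact D.map_algebraMap c
    | add p q hp hq => rw [map_add, map_add, hp, hq, add_zero]
    | mul_X p i hp =>
      rw [map_mul, Derivation.leibniz, hp, smul_zero, add_zero]
      have : D (linSub B j u (X i)) = 0 := by
        rw [linSub, aeval_X, map_sub, Derivation.leibniz, hDX, hDX, hDC, smul_zero, add_zero,
          smul_eq_mul, ← C_mul, mul_assoc, inv_mul_cancel₀ hu, mul_one, sub_self]
      rw [this, smul_zero]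
  rw [← hD]
  induction g using Polynomial.induction_on' with
  | add p q hp hq => rw [map_add, map_add, hp, hq, Polynomial.derivative_add, map_add]
  | monomial m a =>
    rw [Polynomial.derivative_monomial, ← Polynomial.C_mul_X_pow_eq_monomial,
      ← Polynomial.C_mul_X_pow_eq_monomial, RingHom.map_mul (psiHom B j u),
      RingHom.map_mul (psiHom B j u), RingHom.map_pow (psiHom B j u),
      RingHom.map_pow (psiHom B j u), psiHom_C, psiHom_C,
      Derivation.leibniz, hDlin, smul_zero, add_zero, Derivation.leibniz_pow, psiHom_X,
      Derivation.leibniz, hDX, hDC, smul_zero, add_zero, smul_eq_mul, smul_eq_mul, smul_eq_mul,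
      ← C_mul, inv_mul_cancel₀ hu, map_mul, map_natCast]
    simp
    ring

/-! ### The affine subspace -/

/-- The affine subspace `x_i - (u_i / u_j) x_j = a_i` for `i ∈ B`. -/
def linSpace {K : Type*} [Field K] {n : ℕ} (B : Finset (Fin n)) (j : Fin n)
    (u : Fin n → K) (a : B → K) : Set (Fin n → K) :=
  {x | ∀ i : B, x i.1 - u i.1 * (u j)⁻¹ * x j = a i}

theorem linSpace_eq {K : Type*} [Field K] {n : ℕ} (B : Finset (Fin n)) (j : Fin n)
    (u : Fin n → K) (a : B → K) : linSpace B j u a = _root_.zeroLocus K n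
      (Set.range fun i : B => X i.1 - C (u i.1 * (u j)⁻¹) * X j - C (a i)) := by
  ext x
  simp only [linSpace, _root_.zeroLocus, Set.mem_ofPred_eq, Set.forall_mem_range]
  refine forall_congr' fun i => ?_
  simp only [map_sub, map_mul, eval_X, eval_C]
  exact sub_eq_zero.symm

theorem linSpace_isAffineSubspace {K : Type*} [Field K] {n : ℕ} (B : Finset (Fin n)) (j : Fin n)
    (u : Fin n → K) (a : B → K) : IsAffineSubspace K n (linSpace B j u a) := by
  refine ⟨_, ?_, linSpace_eq B j u a⟩
  rintro _ ⟨i, rfl⟩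
  refine (totalDegree_sub _ _).trans (max_le ((totalDegree_sub _ _).trans (max_le ?_ ?_)) ?_)
  · simp
  · refine (totalDegree_mul _ _).trans ?_
    rw [totalDegree_C, totalDegree_X]
  · simp

theorem linSpace_vdim {K : Type*} [Field K] [IsAlgClosed K] {n : ℕ} (B : Finset (Fin n))
    (j : Fin n) (hj : j ∉ B) (u : Fin n → K) (a : B → K) :
    (B.card : WithBot ℕ∞) + vdim K n (linSpace B j u a) = (n : WithBot ℕ∞) := by
  classical
  let T := {i : Fin n // i ∉ B}
  have hcl : IsClosed (linSpace B j u a) := by rw [linSpace_eq]; exact zL_isClosed _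
  let ρ : MvPolynomial (Fin n) K →ₐ[K] MvPolynomial T K := aeval (fun i =>
    if h : i ∈ B then C (a ⟨i, h⟩) + C (u i * (u j)⁻¹) * X ⟨j, hj⟩ else X ⟨i, h⟩)
  let pt : (T → K) → (Fin n → K) := fun z i =>
    if h : i ∈ B then a ⟨i, h⟩ + u i * (u j)⁻¹ * z ⟨j, hj⟩ else z ⟨i, h⟩
  have hpt : ∀ z f, eval z (ρ f) = eval (pt z) f := by
    intro z f
    have : ((aeval z).comp ρ : MvPolynomial (Fin n) K →ₐ[K] K) = aeval (pt z) := by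
      ext i
      simp only [AlgHom.comp_apply, ρ, aeval_X, pt]
      split_ifs <;> simp
    have h2 := DFunLike.congr_fun this f
    simpa [AlgHom.comp_apply, aeval_eq_eval] using h2
  have hptL : ∀ z, pt z ∈ linSpace B j u a := by
    intro z i
    simp only [pt, dif_neg hj, dif_pos i.2]
    ring
  have hLpt : ∀ x ∈ linSpace B j u a, x = pt (fun i => x i.1) := by
    intro x hx
    funext i
    simp only [pt]
    split_ifs with h
    · rw [← hx ⟨i, h⟩]; ring
    · rfl
  have hker : RingHom.ker ρ.toRingHom = _root_.vanishingIdeal K n (linSpace B j u a) := by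
    ext f
    rw [mem_vI, RingHom.mem_ker]
    constructor
    · intro h x hx
      have h0 : ρ f = 0 := h
      have h1 := hpt (fun i => x i.1) f
      rw [← hLpt x hx, h0, map_zero] at h1
      exact h1.symm
    · intro h
      change ρ f = 0
      apply MvPolynomial.funext
      intro z
      rw [hpt, map_zero]
      exact h _ (hptL z)
  have hsurj : Function.Surjective ρ.toRingHom := by
    intro g
    refine ⟨rename Subtype.val g, ?_⟩
    have : (ρ.comp (rename Subtype.val)) = AlgHom.id K (MvPolynomial T K) := by
      ext1 i
      simp [ρ, i.2]
      rfl
    exact DFunLike.congr_fun this g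
  rw [vdim_eq_ringKrullDim hcl, ← hker,
    ringKrullDim_eq_of_ringEquiv (RingHom.quotientKerEquivOfSurjective hsurj),
    MvPolynomial.ringKrullDim_of_isNoetherianRing, ringKrullDim_eq_zero_of_field, zero_add]
  have hT : Nat.card T + B.card = n := by
    rw [Nat.card_eq_fintype_card, Fintype.card_subtype_compl, Fintype.card_coe, Fintype.card_fin]
    exact Nat.sub_add_cancel (by simpa using Finset.card_le_univ B)
  rw [add_comm]
  exact_mod_cast hT

/-! ### Generic fibres -/

theorem generic_fibre {K A : Type*} [Field K] [IsAlgClosed K] [CommRing A] [IsDomain A]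
    {B : Type} [Algebra K A] [Algebra (MvPolynomial B K) A]
    [IsScalarTower K (MvPolynomial B K) A] [FaithfulSMul (MvPolynomial B K) A]
    [Algebra.IsAlgebraic (MvPolynomial B K) A] {n : ℕ} (ξ : Fin n → A)
    (hgen : Algebra.adjoin K (Set.range ξ) = ⊤)
    (y : A) (hy : IsIntegral (MvPolynomial B K) y)
    (hd : Polynomial.derivative (minpoly (MvPolynomial B K) y) ≠ 0) :
    ∃ a : B → K, (∀ i, {z : K | ∃ χ : A →+* K,
        (∀ p, χ (algebraMap (MvPolynomial B K) A p) = eval a p) ∧ χ (ξ i) = z}.Finite) ∧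
      ∃ s : Finset K, s.card = (minpoly (MvPolynomial B K) y).natDegree ∧
        ∀ y₀ ∈ s, (RingHom.ker (Polynomial.eval₂RingHom (eval a) y₀)).map
          (Polynomial.aeval (R := MvPolynomial B K) y).toRingHom ≠ ⊤ := by
  classical
  set P := MvPolynomial B K with hP
  set μ := minpoly P y with hμ
  have hμm : μ.Monic := minpoly.monic hy
  -- the derivative does not vanish at `y`
  have hdy : Polynomial.aeval y (Polynomial.derivative μ) ≠ 0 := by
    intro h
    have h1 := minpoly.IsIntegrallyClosed.degree_le_of_ne_zero hd h
    exact absurd h1 (not_le.mpr (Polynomial.degree_derivative_lt hμm.ne_zero))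
  obtain ⟨c, hc0, e, hce⟩ := (Algebra.IsAlgebraic.isAlgebraic (R := P)
    (Polynomial.aeval y (Polynomial.derivative μ))).exists_nonzero_dvd
    (mem_nonZeroDivisors_of_ne_zero hdy)
  obtain ⟨v, hv0, hv⟩ := Algebra.IsAlgebraic.exists_integral_multiples (R := P)
    (Finset.univ.image ξ)
  have hv' : ∀ i, IsIntegral P (v • ξ i) := fun i => hv _ (by simp)
  have hvN : ∀ a : A, ∃ N : ℕ, IsIntegral P (v ^ N • a) := by
    intro a
    have ha : a ∈ Algebra.adjoin K (Set.range ξ) := by rw [hgen]; trivial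
    induction ha using Algebra.adjoin_induction with
    | mem x hx => obtain ⟨i, rfl⟩ := hx; exact ⟨1, by simpa using hv' i⟩
    | algebraMap r =>
      refine ⟨0, ?_⟩
      rw [pow_zero, one_smul, IsScalarTower.algebraMap_apply K P A]
      exact isIntegral_algebraMap
    | add x z _ _ hx hz =>
      obtain ⟨N, hN⟩ := hx
      obtain ⟨M, hM⟩ := hz
      refine ⟨N + M, ?_⟩
      have : v ^ (N + M) • (x + z) = v ^ M • (v ^ N • x) + v ^ N • (v ^ M • z) := by
        rw [smul_smul, smul_smul, smul_add, ← pow_add, ← pow_add, add_comm M N]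
      rw [this]
      exact (hN.smul _).add (hM.smul _)
    | mul x z _ _ hx hz =>
      obtain ⟨N, hN⟩ := hx
      obtain ⟨M, hM⟩ := hz
      refine ⟨N + M, ?_⟩
      have : v ^ (N + M) • (x * z) = (v ^ N • x) * (v ^ M • z) := by
        rw [smul_mul_smul_comm, pow_add]
      rw [this]
      exact hN.mul hM
  obtain ⟨a, ha⟩ : ∃ a : B → K, eval a (c * v) ≠ 0 := by
    by_contra! h
    exact mul_ne_zero hc0 hv0 (MvPolynomial.funext fun x => by simpa using h x)
  rw [map_mul] at ha
  have hac : eval a c ≠ 0 := left_ne_zero_of_mul ha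
  have hav : eval a v ≠ 0 := right_ne_zero_of_mul ha
  refine ⟨a, ?_, (μ.map (eval a)).roots.toFinset, ?_, ?_⟩
  · intro i
    obtain ⟨r, hr, hri⟩ := hv' i
    have hr0 : r.map (eval a) ≠ 0 := (hr.map _).ne_zero
    refine Set.Finite.subset (((r.map (eval a)).roots.toFinset.finite_toSet).image
      (fun z => (eval a v)⁻¹ * z)) ?_
    rintro z ⟨χ, hχ, rfl⟩
    refine ⟨eval a v * χ (ξ i), ?_, ?_⟩
    · rw [Finset.mem_coe, Multiset.mem_toFinset, Polynomial.mem_roots hr0, Polynomial.IsRoot,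
        Polynomial.eval_map]
      have h1 := congrArg χ hri
      rw [Polynomial.hom_eval₂, map_zero, Algebra.smul_def, map_mul, hχ] at h1
      have h2 : χ.comp (algebraMap P A) = eval a := by
        apply RingHom.ext
        intro p
        exact hχ p
      rw [h2] at h1
      exact h1
    · simp only
      rw [← mul_assoc, inv_mul_cancel₀ hav, one_mul]
  · have hmap0 : μ.map (eval a) ≠ 0 := (hμm.map _).ne_zero
    have hnd : (μ.map (eval a)).roots.Nodup := by
      rw [Multiset.nodup_iff_count_le_one]
      intro y₀
      by_contra hcon
      rw [Polynomial.count_roots, not_le,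
        Polynomial.one_lt_rootMultiplicity_iff_isRoot hmap0] at hcon
      obtain ⟨h1, h2⟩ := hcon
      rw [Polynomial.IsRoot, Polynomial.eval_map] at h1
      rw [Polynomial.derivative_map, Polynomial.IsRoot, Polynomial.eval_map] at h2
      have hne := fibre_ne_top y hy v hvN (eval a) hav y₀ h1
      apply hne
      set I := (RingHom.ker (Polynomial.eval₂RingHom (eval a) y₀)).map
          (Polynomial.aeval (R := P) y).toRingHom with hI
      have hm1 : algebraMap P A c ∈ I := by
        rw [hce]
        apply Ideal.mul_mem_right
        exact Ideal.mem_map_of_mem (Polynomial.aeval (R := P) y).toRingHom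
          (show Polynomial.derivative μ ∈ _ from h2)
      have hm2 : algebraMap P A (c - C (eval a c)) ∈ I := by
        have : Polynomial.C (c - C (eval a c)) ∈
            RingHom.ker (Polynomial.eval₂RingHom (eval a) y₀) := by
          rw [RingHom.mem_ker, Polynomial.coe_eval₂RingHom, Polynomial.eval₂_C, map_sub, eval_C,
            sub_self]
        have h3 := Ideal.mem_map_of_mem (Polynomial.aeval (R := P) y).toRingHom this
        have h4 : (Polynomial.aeval (R := P) y).toRingHom (Polynomial.C (c - C (eval a c))) =
          algebraMap P A (c - C (eval a c)) := Polynomial.aeval_C _ _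
        rw [h4] at h3
        exact h3
      have hm3 : algebraMap P A (C (eval a c)) ∈ I := by
        have := I.sub_mem hm1 hm2
        rwa [← map_sub, sub_sub_cancel] at this
      exact Ideal.eq_top_of_isUnit_mem I hm3
        (((IsUnit.mk0 _ hac).map (C : K →+* MvPolynomial B K)).map (algebraMap P A))
    rw [Multiset.toFinset_card_of_nodup hnd, IsAlgClosed.card_roots_eq_natDegree,
      hμm.natDegree_map]
  · intro y₀ hy₀
    rw [Multiset.mem_toFinset, Polynomial.mem_roots (hμm.map _).ne_zero, Polynomial.IsRoot,
      Polynomial.eval_map] at hy₀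
    exact fibre_ne_top y hy v hvN (eval a) hav y₀ hy₀

theorem psi_minpoly {K A : Type*} [Field K] [CommRing A] [IsDomain A] [Algebra K A]
    {n : ℕ} (B : Finset (Fin n)) (j : Fin n) (hj : j ∉ B) (u : Fin n → K) (hu : u j ≠ 0)
    [Algebra (MvPolynomial B K) A] (π : MvPolynomial (Fin n) K →ₐ[K] A) (y : A)
    (hπ : ∀ g, Polynomial.aeval y g = π (psiHom B j u g))
    (f : MvPolynomial (Fin n) K) (hf : Irreducible f) (hfv : f.vars ⊆ insert j B)
    (hfπ : π f = 0) (hu1 : eval u (homogeneousComponent f.totalDegree f) ≠ 0)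
    (hu2 : ∑ i, C (u i) * pderiv i f ≠ 0) :
    IsIntegral (MvPolynomial B K) y ∧ (FaithfulSMul (MvPolynomial B K) A →
      (minpoly (MvPolynomial B K) y).natDegree = f.totalDegree ∧
      Polynomial.derivative (minpoly (MvPolynomial B K) y) ≠ 0) := by
  set P := MvPolynomial B K with hP
  set G := thetaHom B u f with hG
  have hψG : psiHom B j u G = f := psi_theta B j hj u hu f hfv
  have hGy : Polynomial.aeval y G = 0 := by rw [hπ, hψG, hfπ]
  obtain ⟨hl1, hl2⟩ := line_restrict (P := P)
    (fun i => if h : i ∈ B then X ⟨i, h⟩ else 0) u f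
  change G.natDegree ≤ _ at hl1
  change G.coeff _ = _ at hl2
  have hGd : G.natDegree = f.totalDegree := by
    apply le_antisymm hl1
    apply Polynomial.le_natDegree_of_ne_zero
    rw [hl2, MvPolynomial.algebraMap_eq]
    simpa using hu1
  have hGl : IsUnit G.leadingCoeff := by
    rw [Polynomial.leadingCoeff, hGd, hl2]
    exact (IsUnit.mk0 _ hu1).map _
  have hyInt : IsIntegral P y := by
    obtain ⟨c, hc⟩ := hGl
    refine ⟨Polynomial.C (c⁻¹ : Pˣ).1 * G, ?_, ?_⟩
    · rw [Polynomial.Monic, Polynomial.leadingCoeff_mul, Polynomial.leadingCoeff_C, ← hc]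
      exact c.inv_mul
    · rw [Polynomial.eval₂_mul]
      have : Polynomial.eval₂ (algebraMap P A) y G = 0 := hGy
      rw [this, mul_zero]
  refine ⟨hyInt, fun _ => ?_⟩
  obtain ⟨r, hr⟩ := minpoly.isIntegrallyClosed_dvd hyInt hGy
  set μ := minpoly P y with hμ
  have hfr : f = psiHom B j u μ * psiHom B j u r := by rw [← map_mul, ← hr, hψG]
  have hru : IsUnit r := by
    rcases hf.isUnit_or_isUnit hfr with h | h
    · exfalso
      have h1 := h.map π
      rw [← hπ, hμ, minpoly.aeval] at h1
      exact not_isUnit_zero h1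
    · have := h.map (thetaHom B u)
      rwa [theta_psi B j hj u hu] at this
  obtain ⟨e, he, rfl⟩ := Polynomial.isUnit_iff.mp hru
  have hμ0 : μ ≠ 0 := (minpoly.monic hyInt).ne_zero
  constructor
  · rw [← hGd, hr, Polynomial.natDegree_mul_C he.ne_zero]
  · intro h0
    apply hu2
    have h1 : Polynomial.derivative G = 0 := by
      rw [hr, Polynomial.derivative_mul, h0, Polynomial.derivative_C]
      simp
    have h2 := deriv_psi B j u hu G
    rw [hψG, h1, map_zero] at h2
    exact h2

theorem linear_basis {K A : Type*} [Field K] [CommRing A] [IsDomain A] [Algebra K A]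
    {n : ℕ} (B : Finset (Fin n)) (j : Fin n) (u : Fin n → K)
    [Algebra (MvPolynomial B K) A] [IsScalarTower K (MvPolynomial B K) A]
    (π : MvPolynomial (Fin n) K →ₐ[K] A) (y : A)
    (hπ : ∀ g, Polynomial.aeval y g = π (psiHom B j u g))
    (hB : IsTranscendenceBasis K (fun i : B => π (X i)))
    (hy : IsIntegral (MvPolynomial B K) y) :
    FaithfulSMul (MvPolynomial B K) A ∧ Algebra.IsAlgebraic (MvPolynomial B K) A := by
  set P := MvPolynomial B K with hP
  let t : B → A := fun i => algebraMap P A (X i)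
  have hav : aeval t = IsScalarTower.toAlgHom K P A := by
    ext i
    simp [t]
    rfl
  have hy' : y = π (C (u j)⁻¹ * X j) := by
    have := hπ Polynomial.X
    rwa [Polynomial.aeval_X, psiHom_X] at this
  have ht : ∀ i : B, t i = π (X i.1 - C (u i.1 * (u j)⁻¹) * X j) := by
    intro i
    have := hπ (Polynomial.C (X i))
    rwa [Polynomial.aeval_C, psiHom_C, linSub, aeval_X] at this
  have hrange : (Algebra.adjoin K (Set.range t) : Set A) = Set.range (algebraMap P A) := by
    rw [Algebra.adjoin_range_eq_range_aeval, hav]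
    rfl
  have hmem : ∀ p, algebraMap P A p ∈ Algebra.adjoin K (Set.range t) := by
    intro p
    have : algebraMap P A p ∈ (Algebra.adjoin K (Set.range t) : Set A) := by
      rw [hrange]; exact ⟨p, rfl⟩
    exact this
  have hyS : IsAlgebraic (Algebra.adjoin K (Set.range t)) y := by
    obtain ⟨q, hq, hqy⟩ := hy
    have : IsIntegral (Algebra.adjoin K (Set.range t)) y := by
      refine ⟨q.map ((algebraMap P A).codRestrict (Algebra.adjoin K (Set.range t)) hmem),
        hq.map _, ?_⟩
      rw [Polynomial.eval₂_map]
      exact hqy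
    exact this.isAlgebraic
  have halg : Algebra.IsAlgebraic (Algebra.adjoin K (Set.range t)) A := by
    constructor
    intro a
    have h1 := hB.isAlgebraic.isAlgebraic a
    refine h1.adjoin_of_forall_isAlgebraic ?_
    rintro x ⟨⟨i, rfl⟩, -⟩
    have hx : π (X i.1) = t i + algebraMap K A (u i) * y := by
      rw [ht, hy', ← MvPolynomial.algebraMap_eq]
      simp only [map_sub, map_mul, AlgHom.commutes]
      ring
    simp only
    rw [hx]
    refine IsAlgebraic.add ?_ (IsAlgebraic.mul ?_ hyS)
    · exact isAlgebraic_algebraMap (⟨t i, Algebra.subset_adjoin ⟨i, rfl⟩⟩ :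
        Algebra.adjoin K (Set.range t))
    · exact isAlgebraic_algebraMap (algebraMap K (Algebra.adjoin K (Set.range t)) (u i))
  have htb : IsTranscendenceBasis K t := by
    apply Algebra.IsAlgebraic.isTranscendenceBasis_of_lift_le_trdeg_of_finite
    exact hB.lift_cardinalMk_eq_trdeg.le
  constructor
  · rw [faithfulSMul_iff_algebraMap_injective]
    have h1 := htb.1
    rw [AlgebraicIndependent, hav] at h1
    exact h1
  · constructor
    intro a
    obtain ⟨q, hq0, hqa⟩ := halg.isAlgebraic a
    have hl : ∀ s : Algebra.adjoin K (Set.range t), ∃ p : P, algebraMap P A p = s := by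
      intro s
      have : (s : A) ∈ (Algebra.adjoin K (Set.range t) : Set A) := s.2
      rw [hrange] at this
      exact this
    have hsurj : Function.Surjective
        ((algebraMap P A).codRestrict (Algebra.adjoin K (Set.range t)) hmem) := by
      intro s
      obtain ⟨p, hp⟩ := hl s
      exact ⟨p, Subtype.ext hp⟩
    obtain ⟨q', rfl⟩ := Polynomial.map_surjective _ hsurj q
    refine ⟨q', ?_, ?_⟩
    · rintro rfl; simp at hq0
    · rw [Polynomial.aeval_def, Polynomial.eval₂_map] at hqa
      exact hqa

/-! ### The case of an irreducible variety -/

theorem core_irreducible {K : Type*} [Field K] [IsAlgClosed K] {n : ℕ} {W : Set (Fin n → K)}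
    (hWc : IsClosed W) (hWi : IsIrreducible W) (J : Finset (Fin n))
    (hJ : vdim K n W < (J.card : WithBot ℕ∞)) :
    ∃ f : MvPolynomial (Fin n) K, f ≠ 0 ∧ f.vars ⊆ J ∧ (∀ x ∈ W, eval x f = 0) ∧
      (f.totalDegree : ℕ∞) ≤ irrDegree K n W := by
  classical
  set p := _root_.vanishingIdeal K n W with hp
  have hpp : p.IsPrime := vI_isPrime hWi
  let π : MvPolynomial (Fin n) K →ₐ[K] (MvPolynomial (Fin n) K ⧸ p) := Ideal.Quotient.mkₐ K p
  have hπs : Function.Surjective π := Ideal.Quotient.mkₐ_surjective K p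
  have hπ0 : ∀ f, π f = 0 ↔ f ∈ p := fun f => Ideal.Quotient.eq_zero_iff_mem
  have hdim := vdim_eq_ringKrullDim hWc
  rw [hdim] at hJ
  have haev : aeval (fun i => π (X i)) = π := by ext i; simp
  have hgen : Algebra.adjoin K (Set.range fun i => π (X i)) = ⊤ := by
    rw [Algebra.adjoin_range_eq_range_aeval, haev]
    exact (AlgHom.range_eq_top π).mpr hπs
  obtain ⟨B, j, hjB, hBt, hBc, q, hq0, hqJ, hqB, hqξ⟩ :=
    exists_coord_basis (fun i => π (X i)) hgen J hJ
  rw [haev, hπ0] at hqξ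
  obtain ⟨f, hfi, hfp, hfv⟩ := exists_irred_factor p q hq0 hqξ
  refine ⟨f, hfi.ne_zero, hfv.trans hqJ, fun x hx => mem_vI.mp hfp x hx, ?_⟩
  obtain ⟨u, huj, hu1, hu2⟩ := exists_direction hfi j
  let _ : Algebra (MvPolynomial B K) (MvPolynomial (Fin n) K ⧸ p) :=
    (π.comp (linSub B j u)).toRingHom.toAlgebra
  have halg : ∀ r, algebraMap (MvPolynomial B K) (MvPolynomial (Fin n) K ⧸ p) r =
    π (linSub B j u r) := fun r => rfl
  have htower : IsScalarTower K (MvPolynomial B K) (MvPolynomial (Fin n) K ⧸ p) := by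
    apply IsScalarTower.of_algebraMap_eq
    intro c
    rw [halg, AlgHom.commutes, AlgHom.commutes]
  let y : MvPolynomial (Fin n) K ⧸ p := π (C (u j)⁻¹ * X j)
  have hπψ : ∀ g, Polynomial.aeval y g = π (psiHom B j u g) := by
    intro g
    rw [Polynomial.aeval_def, psiHom, Polynomial.coe_eval₂RingHom]
    exact (Polynomial.hom_eval₂ g (linSub B j u).toRingHom π.toRingHom _).symm
  obtain ⟨hyint, hmin⟩ := psi_minpoly B j hjB u huj π y hπψ f hfi (hfv.trans hqB)
    ((hπ0 f).mpr hfp) hu1 hu2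
  obtain ⟨hfaith, hisalg⟩ := linear_basis B j u π y hπψ hBt hyint
  obtain ⟨hdeg, hder⟩ := hmin hfaith
  obtain ⟨a, hfin, s, hsc, hs⟩ := generic_fibre (fun i => π (X i)) hgen y hyint hder
  have hWL : (W ∩ linSpace B j u a).Finite := by
    refine Set.Finite.subset (Set.Finite.pi' hfin) ?_
    rintro w ⟨hwW, hwL⟩ i
    let χ : (MvPolynomial (Fin n) K ⧸ p) →+* K :=
      Ideal.Quotient.lift p (eval w) (fun g hg => mem_vI.mp hg w hwW)
    have hχ : ∀ g, χ (π g) = eval w g := fun g => Ideal.Quotient.lift_mk _ _ _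
    refine ⟨χ, ?_, ?_⟩
    · intro r
      rw [halg, hχ]
      have h1 : ((aeval w).comp (linSub B j u) : MvPolynomial B K →ₐ[K] K) = aeval a := by
        ext i
        have := hwL i
        simp only [AlgHom.comp_apply, linSub, aeval_X, map_sub, map_mul, aeval_C]
        exact this
      have h2 := DFunLike.congr_fun h1 r
      simpa [AlgHom.comp_apply, aeval_eq_eval] using h2
    · rw [hχ, eval_X]
  have hpts : (s : Set K) ⊆ (fun w : Fin n → K => (u j)⁻¹ * w j) '' (W ∩ linSpace B j u a) := by
    intro y₀ hy₀
    obtain ⟨M, hM, hIM⟩ := Ideal.exists_le_maximal _ (hs y₀ hy₀)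
    have hMc : (M.comap π.toRingHom).IsMaximal := Ideal.comap_isMaximal_of_surjective _ hπs
    obtain ⟨w, hw⟩ := MvPolynomial.isMaximal_iff_eq_vanishingIdeal_singleton.mp hMc
    have hMw : ∀ g, π g ∈ M → eval w g = 0 := by
      intro g hg
      have h1 : g ∈ M.comap π.toRingHom := hg
      rw [hw, MvPolynomial.mem_vanishingIdeal_singleton_iff] at h1
      simpa [aeval_eq_eval] using h1
    have hker : ∀ g : Polynomial (MvPolynomial B K),
        g.eval₂ (eval a) y₀ = 0 → eval w (psiHom B j u g) = 0 := by
      intro g hg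
      apply hMw
      rw [← hπψ]
      exact hIM (Ideal.mem_map_of_mem (Polynomial.aeval (R := MvPolynomial B K) y).toRingHom hg)
    refine ⟨w, ⟨?_, ?_⟩, ?_⟩
    · rw [← zL_vI_of_isClosed hWc]
      intro g hg
      apply hMw
      rw [(hπ0 g).mpr hg]
      exact M.zero_mem
    · intro i
      have := hker (Polynomial.C (X i - C (a i))) (by simp)
      rw [psiHom_C, map_sub, linSub, aeval_X, aeval_C, MvPolynomial.algebraMap_eq, map_sub, map_sub,
        map_mul, eval_C, eval_C, eval_X, eval_X] at this
      exact sub_eq_zero.mp this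
    · have := hker (Polynomial.X - Polynomial.C (C y₀)) (by simp)
      rw [map_sub, psiHom_C, psiHom_X, linSub, aeval_C, MvPolynomial.algebraMap_eq, map_sub,
        map_mul, eval_C, eval_C, eval_X] at this
      exact sub_eq_zero.mp this
  have hcard : f.totalDegree ≤ (W ∩ linSpace B j u a).ncard := by
    rw [← hdeg, ← hsc, ← Set.ncard_coe_finset]
    exact (Set.ncard_le_ncard hpts (hWL.image _)).trans (Set.ncard_image_le hWL)
  have hsum : vdim K n W + vdim K n (linSpace B j u a) = (n : WithBot ℕ∞) := by
    rw [hdim, hBc]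
    exact linSpace_vdim B j hjB u a
  calc (f.totalDegree : ℕ∞) ≤ ((W ∩ linSpace B j u a).ncard : ℕ∞) := by exact_mod_cast hcard
    _ ≤ irrDegree K n W := by
      unfold irrDegree
      exact le_iSup_of_le (linSpace B j u a) (le_iSup_of_le (linSpace_isAffineSubspace B j u a)
        (le_iSup_of_le hsum (le_iSup_of_le hWL le_rfl)))

/-! ### Assembly -/

theorem main_over_closure {K : Type*} [Field K] [IsAlgClosed K] {n k d : ℕ}
    (V : Set (Fin n → K)) (hV : IsClosed V)
    (hVdim : vdim K n V = (k : WithBot ℕ∞)) (hVdeg : vdeg K n V = (d : ℕ∞))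
    (J : Finset (Fin n)) (hJ : J.card = k + 1) :
    ∃ f : MvPolynomial (Fin n) K, f ≠ 0 ∧ f.vars ⊆ J ∧ f.totalDegree ≤ d ∧
      ∀ x ∈ V, eval x f = 0 := by
  classical
  have hN : TopologicalSpace.NoetherianSpace (Fin n → K) := noetherian_zariski
  have hNV : TopologicalSpace.NoetherianSpace V :=
    Topology.IsInducing.subtypeVal.noetherianSpace
  have hfinite : (irreducibleComponents ↥V).Finite :=
    TopologicalSpace.NoetherianSpace.finite_irreducibleComponents
  have hFin : Fintype (irreducibleComponents ↥V) := hfinite.fintype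
  have hex : ∀ W : irreducibleComponents ↥V, ∃ f : MvPolynomial (Fin n) K, f ≠ 0 ∧ f.vars ⊆ J ∧
      (∀ x ∈ Subtype.val '' (W.1 : Set ↥V), eval x f = 0) ∧
      (f.totalDegree : ℕ∞) ≤ irrDegree K n (Subtype.val '' (W.1 : Set ↥V)) := by
    intro W
    have hWc : IsClosed (Subtype.val '' (W.1 : Set ↥V)) :=
      hV.isClosedEmbedding_subtypeVal.isClosedMap _
        (isClosed_of_mem_irreducibleComponents W.1 W.2)
    have hWi : IsIrreducible (Subtype.val '' (W.1 : Set ↥V)) :=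
      IsIrreducible.image (Maximal.prop W.2) _ continuous_subtype_val.continuousOn
    have hsub : Subtype.val '' (W.1 : Set ↥V) ⊆ V := by
      rintro _ ⟨x, -, rfl⟩; exact x.2
    refine core_irreducible hWc hWi J ?_
    have hle : vdim K n (Subtype.val '' (W.1 : Set ↥V)) ≤ vdim K n V :=
      (Topology.IsEmbedding.inclusion hsub).isInducing.topologicalKrullDim_le
    refine lt_of_le_of_lt hle ?_
    rw [hVdim, hJ]
    exact_mod_cast Nat.lt_succ_self k
  choose f hf0 hfJ hfW hfd using hex
  refine ⟨∏ W, f W, Finset.prod_ne_zero_iff.mpr fun W _ => hf0 W, ?_, ?_, ?_⟩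
  · intro i hi
    have h1 := vars_prod (fun W => f W) hi
    obtain ⟨W, -, hW⟩ := Finset.mem_biUnion.mp h1
    exact hfJ W hW
  · have h1 : ((∏ W, f W).totalDegree : ℕ∞) ≤ (d : ℕ∞) := by
      rw [← hVdeg, vdeg, tsum_fintype]
      calc ((∏ W, f W).totalDegree : ℕ∞) ≤ ((∑ W, (f W).totalDegree : ℕ) : ℕ∞) := by
            exact_mod_cast totalDegree_finsetProd _ _
        _ = ∑ W, ((f W).totalDegree : ℕ∞) := by push_cast; rfl
        _ ≤ _ := Finset.sum_le_sum fun W _ => hfd W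
    exact_mod_cast h1
  · intro x hx
    rw [map_prod]
    let x' : V := ⟨x, hx⟩
    have hmem : irreducibleComponent x' ∈ irreducibleComponents ↥V :=
      irreducibleComponent_mem_irreducibleComponents x'
    exact Finset.prod_eq_zero (Finset.mem_univ ⟨_, hmem⟩)
      (hfW ⟨_, hmem⟩ x ⟨x', mem_irreducibleComponent, rfl⟩)

theorem projection_polynomial_over_subfield
    {F K : Type*} [Field F] [Field K] [IsAlgClosed K] [Algebra F K] [Algebra.IsAlgebraic F K]
    {n k d : ℕ}
    (V : Set (Fin n → K)) (hV : IsAffineVariety K n V)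
    (hF : DefinedOver F K n V)
    (hkn : k < n) (hVdim : vdim K n V = (k : WithBot ℕ∞)) (hVdeg : vdeg K n V = (d : ℕ∞))
    (J : Finset (Fin n)) (hJ : J.card = k + 1) :
    ∃ f : MvPolynomial (Fin n) F, f ≠ 0 ∧ f.vars ⊆ J ∧ f.totalDegree ≤ d ∧
      ∀ x ∈ V, eval x (MvPolynomial.map (algebraMap F K) f) = 0 := by
  have hVc : IsClosed V := by
    obtain ⟨s, hs⟩ := hV
    rw [hs]
    exact zL_isClosed _
  obtain ⟨f, hf0, hfJ, hfd, hfV⟩ := main_over_closure V hVc hVdim hVdeg J hJ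
  obtain ⟨s, hs⟩ := hF
  have hfs : f ∈ Ideal.span (MvPolynomial.map (algebraMap F K) '' (s : Set _)) := by
    rw [← hs]; exact mem_vI.mpr hfV
  obtain ⟨g, hg0, hgs, hgI⟩ := descent_aux (s : Set (MvPolynomial (Fin n) F)) f hfs hf0
  refine ⟨g, hg0, ?_, ?_, ?_⟩
  · intro i hi
    apply hfJ
    rw [mem_vars_iff_mem_support] at hi ⊢
    obtain ⟨m, hm, hi⟩ := hi
    exact ⟨m, hgs hm, hi⟩
  · refine le_trans ?_ hfd
    exact Finset.sup_mono hgs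
  · have h1 : MvPolynomial.map (algebraMap F K) g ∈
        Ideal.span (MvPolynomial.map (algebraMap F K) '' (s : Set _)) := by
      rw [← Ideal.map_span]
      exact Ideal.mem_map_of_mem _ hgI
    rw [← hs] at h1
    exact fun x hx => mem_vI.mp h1 x hx
end
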